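/- Suppose MN > 0 and (M,N) ≠ (1,1). Let V be a finite-dimensional nonzero U'-module. Then there exist a nonzero ℤ/2-homogeneous vector v ∈ V, signs ε_i ∈ {±1} for 1 ≤ i ≤ M+N−1, i ≠ M, a scalar t ∈ ℂ∖{0}, and (P̲, f, c; Q) ∈ R̃_{M,N} with Q(z) = Σ_{s=0}^{d} a_s z^s such that: X⁺_{i,n} v = 0 for all i, n; K₀ v = t v; Σ_n φ^±_{i,n} z^n v = ε_i q_i^{deg P_i} (P_i(z q_i^{−1})/P_i(z q_i)) v for i ≠ M; K_M v = c v and Σ_n ((φ⁺_{M,n} − φ⁻_{M,n})/(q − q^{−1})) z^n v = f(z) v; (X⁻_{i,0})^{1+deg P_i} v = 0 for i ≠ M; and Σ_{s=0}^{d} a_{d−s} X⁻_{M,s} v = 0. -/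

import Mathlib

noncomputable section

namespace QAS

open Polynomial
open scoped TensorProduct

/-! ### Basic combinatorial data -/

/-- `l_i = 1` for `i ≤ M`, `-1` otherwise. -/
def lof (M : ℕ) (i : ℕ) : ℤ := if i ≤ M then 1 else -1

/-- the bilinear form `(ε_i, ε_j) = l_i δ_{ij}`. -/
def innerE (M : ℕ) (i j : ℕ) : ℤ := if i = j then lof M i else 0

/-- `(ε_a − ε_b, ε_c − ε_d)`. -/
def form4 (M : ℕ) (a b c d : ℕ) : ℤ :=
  innerE M a c - innerE M a d - innerE M b c + innerE M b d

/-- the Cartan pairing `c_{ij} = (ε_i − ε_{i+1}, ε_j − ε_{j+1})`. -/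
def cc (M : ℕ) (i j : ℕ) : ℤ := form4 M i (i + 1) j (j + 1)

/-- `q_i = q^{l_i}`. -/
def qpar (q : ℂ) (M : ℕ) (i : ℕ) : ℂ := q ^ lof M i

/-- the quantum integer `[m]_v`. -/
def qint (v : ℂ) (m : ℤ) : ℂ := (v ^ m - v ^ (-m)) / (v - v⁻¹)

/-- the sign `(−1)^{|X_i||X_j|}` for the generators `X_i`, `X_j`. -/
def sgn (M : ℕ) (i j : ℕ) : ℂ := if i = M ∧ j = M then -1 else 1

/-- index set `1 ≤ i ≤ M+N−1`. -/
abbrev Idx (M N : ℕ) := {i : ℕ // 1 ≤ i ∧ i ≤ M + N - 1}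

/-! ### Generators and the free superalgebra -/

/-- Drinfel'd generators; when `ext = true` we also have `K₀^{±1}`. -/
inductive Gen (M N : ℕ) (ext : Bool) : Type
  | Xp : Idx M N → ℤ → Gen M N ext
  | Xm : Idx M N → ℤ → Gen M N ext
  | K : Idx M N → Gen M N ext
  | Ki : Idx M N → Gen M N ext
  | H : Idx M N → {s : ℤ // s ≠ 0} → Gen M N ext
  | K0 : ext = true → Gen M N ext
  | K0i : ext = true → Gen M N ext

abbrev FA (M N : ℕ) (ext : Bool) := FreeAlgebra ℂ (Gen M N ext)

def gi {M N : ℕ} {ext : Bool} (g : Gen M N ext) : FA M N ext := FreeAlgebra.ι ℂ g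

def XpF (M N : ℕ) (ext : Bool) (i : ℕ) (n : ℤ) : FA M N ext :=
  if h : 1 ≤ i ∧ i ≤ M + N - 1 then gi (Gen.Xp ⟨i, h⟩ n) else 0

def XmF (M N : ℕ) (ext : Bool) (i : ℕ) (n : ℤ) : FA M N ext :=
  if h : 1 ≤ i ∧ i ≤ M + N - 1 then gi (Gen.Xm ⟨i, h⟩ n) else 0

def KF (M N : ℕ) (ext : Bool) (i : ℕ) : FA M N ext :=
  if h : 1 ≤ i ∧ i ≤ M + N - 1 then gi (Gen.K ⟨i, h⟩) else 0

def KiF (M N : ℕ) (ext : Bool) (i : ℕ) : FA M N ext :=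
  if h : 1 ≤ i ∧ i ≤ M + N - 1 then gi (Gen.Ki ⟨i, h⟩) else 0

def HF (M N : ℕ) (ext : Bool) (i : ℕ) (s : ℤ) : FA M N ext :=
  if h : (1 ≤ i ∧ i ≤ M + N - 1) ∧ s ≠ 0 then gi (Gen.H ⟨i, h.1⟩ ⟨s, h.2⟩) else 0

def K0F (M N : ℕ) (ext : Bool) : FA M N ext :=
  if h : ext = true then gi (Gen.K0 h) else 0

def K0iF (M N : ℕ) (ext : Bool) : FA M N ext :=
  if h : ext = true then gi (Gen.K0i h) else 0

/-- coefficients of `exp (t · Σ_{s ≥ 1} a_s z^s)`. -/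
def expC {A : Type} [Ring A] [Algebra ℂ A] (t : ℂ) (a : ℕ → A) : ℕ → A
  | 0 => 1
  | n + 1 =>
      ((n : ℂ) + 1)⁻¹ •
        (t • ∑ s ∈ Finset.range (n + 1), ((s : ℂ) + 1) • (a (s + 1) * expC t a (n - s)))
termination_by n => n
decreasing_by omega

/-- `φ⁺_{i,n}`, the coefficient of `z^n` in
`K_i exp((q_i − q_i⁻¹) Σ_{s>0} h_{i,s} z^s)`. -/
def phiPF (q : ℂ) (M N : ℕ) (ext : Bool) (i : ℕ) (n : ℤ) : FA M N ext :=
  if 0 ≤ n then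
    KF M N ext i *
      expC (qpar q M i - (qpar q M i)⁻¹) (fun s => HF M N ext i (s : ℤ)) n.toNat
  else 0

/-- `φ⁻_{i,n}`, the coefficient of `z^n` (`n ≤ 0`) in
`K_i⁻¹ exp(−(q_i − q_i⁻¹) Σ_{s>0} h_{i,−s} z^{−s})`. -/
def phiMF (q : ℂ) (M N : ℕ) (ext : Bool) (i : ℕ) (n : ℤ) : FA M N ext :=
  if n ≤ 0 then
    KiF M N ext i *
      expC (-(qpar q M i - (qpar q M i)⁻¹)) (fun s => HF M N ext i (-(s : ℤ))) (-n).toNat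
  else 0

/-- the `u`-bracket `[x,y]_u = xy − u·yx` (for `x` or `y` of even parity). -/
def brF {A : Type} [Ring A] [Module ℂ A] (u : ℂ) (x y : A) : A := x * y - u • (y * x)

/-- the quartic oscillation expression
`[[[X_{M−1,m}, X_{M,n}]_{q⁻¹}, X_{M+1,k}]_q, X_{M,u}]` (a graded anticommutator in the
outermost bracket, both entries being odd). -/
def oscOf {A : Type} [Ring A] [Module ℂ A] (q : ℂ) (M : ℕ) (X : ℕ → ℤ → A) (m n k u : ℤ) : A :=
  brF q (brF q⁻¹ (X (M - 1) m) (X M n)) (X (M + 1) k) * X M u +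
    X M u * brF q (brF q⁻¹ (X (M - 1) m) (X M n)) (X (M + 1) k)

/-! ### The defining relations.
`lvl = 1`: only (R1)–(R3);  `lvl = 2`: (R1)–(R5);  `lvl = 3`: all of (R1)–(R7).
`ext = true` adds `K₀^{±1}` together with its relations. -/

inductive rel (q : ℂ) (M N : ℕ) (ext : Bool) (lvl : ℕ) : FA M N ext → FA M N ext → Prop
  | KKi (i : Idx M N) : rel q M N ext lvl (gi (Gen.K i) * gi (Gen.Ki i)) 1
  | KiK (i : Idx M N) : rel q M N ext lvl (gi (Gen.Ki i) * gi (Gen.K i)) 1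
  | KK (i j : Idx M N) :
      rel q M N ext lvl (gi (Gen.K i) * gi (Gen.K j)) (gi (Gen.K j) * gi (Gen.K i))
  | KKi2 (i j : Idx M N) :
      rel q M N ext lvl (gi (Gen.K i) * gi (Gen.Ki j)) (gi (Gen.Ki j) * gi (Gen.K i))
  | KiKi (i j : Idx M N) :
      rel q M N ext lvl (gi (Gen.Ki i) * gi (Gen.Ki j)) (gi (Gen.Ki j) * gi (Gen.Ki i))
  | KH (i j : Idx M N) (s : {s : ℤ // s ≠ 0}) :
      rel q M N ext lvl (gi (Gen.K i) * gi (Gen.H j s)) (gi (Gen.H j s) * gi (Gen.K i))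
  | KiH (i j : Idx M N) (s : {s : ℤ // s ≠ 0}) :
      rel q M N ext lvl (gi (Gen.Ki i) * gi (Gen.H j s)) (gi (Gen.H j s) * gi (Gen.Ki i))
  | HH (i j : Idx M N) (s t : {s : ℤ // s ≠ 0}) :
      rel q M N ext lvl (gi (Gen.H i s) * gi (Gen.H j t)) (gi (Gen.H j t) * gi (Gen.H i s))
  | KXp (i j : Idx M N) (n : ℤ) :
      rel q M N ext lvl (gi (Gen.K i) * gi (Gen.Xp j n))
        ((q ^ cc M i.1 j.1) • (gi (Gen.Xp j n) * gi (Gen.K i)))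
  | KXm (i j : Idx M N) (n : ℤ) :
      rel q M N ext lvl (gi (Gen.K i) * gi (Gen.Xm j n))
        ((q ^ (-cc M i.1 j.1)) • (gi (Gen.Xm j n) * gi (Gen.K i)))
  | HXp (i j : Idx M N) (s : {s : ℤ // s ≠ 0}) (n : ℤ) :
      rel q M N ext lvl
        (gi (Gen.H i s) * gi (Gen.Xp j n) - gi (Gen.Xp j n) * gi (Gen.H i s))
        ((qint (qpar q M i.1) (s.1 * lof M i.1 * cc M i.1 j.1) / (s.1 : ℂ)) •
          gi (Gen.Xp j (n + s.1)))
  | HXm (i j : Idx M N) (s : {s : ℤ // s ≠ 0}) (n : ℤ) :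
      rel q M N ext lvl
        (gi (Gen.H i s) * gi (Gen.Xm j n) - gi (Gen.Xm j n) * gi (Gen.H i s))
        (-((qint (qpar q M i.1) (s.1 * lof M i.1 * cc M i.1 j.1) / (s.1 : ℂ)) •
          gi (Gen.Xm j (n + s.1))))
  | XpXm (i j : Idx M N) (m n : ℤ) :
      rel q M N ext lvl
        (gi (Gen.Xp i m) * gi (Gen.Xm j n) -
          sgn M i.1 j.1 • (gi (Gen.Xm j n) * gi (Gen.Xp i m)))
        (if i = j then
            (qpar q M i.1 - (qpar q M i.1)⁻¹)⁻¹ •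
              (phiPF q M N ext i.1 (m + n) - phiMF q M N ext i.1 (m + n))
          else 0)
  | XX0p (i j : Idx M N) (m n : ℤ) (h2 : 2 ≤ lvl) (h : cc M i.1 j.1 = 0) :
      rel q M N ext lvl
        (gi (Gen.Xp i m) * gi (Gen.Xp j n) -
          sgn M i.1 j.1 • (gi (Gen.Xp j n) * gi (Gen.Xp i m))) 0
  | XX0m (i j : Idx M N) (m n : ℤ) (h2 : 2 ≤ lvl) (h : cc M i.1 j.1 = 0) :
      rel q M N ext lvl
        (gi (Gen.Xm i m) * gi (Gen.Xm j n) -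
          sgn M i.1 j.1 • (gi (Gen.Xm j n) * gi (Gen.Xm i m))) 0
  | XXp (i j : Idx M N) (m n : ℤ) (h2 : 2 ≤ lvl) (h : cc M i.1 j.1 ≠ 0) :
      rel q M N ext lvl
        (gi (Gen.Xp i (m + 1)) * gi (Gen.Xp j n) -
          (q ^ cc M i.1 j.1) • (gi (Gen.Xp j n) * gi (Gen.Xp i (m + 1))))
        ((q ^ cc M i.1 j.1) • (gi (Gen.Xp i m) * gi (Gen.Xp j (n + 1))) -
          gi (Gen.Xp j (n + 1)) * gi (Gen.Xp i m))
  | XXm (i j : Idx M N) (m n : ℤ) (h2 : 2 ≤ lvl) (h : cc M i.1 j.1 ≠ 0) :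
      rel q M N ext lvl
        (gi (Gen.Xm i (m + 1)) * gi (Gen.Xm j n) -
          (q ^ (-cc M i.1 j.1)) • (gi (Gen.Xm j n) * gi (Gen.Xm i (m + 1))))
        ((q ^ (-cc M i.1 j.1)) • (gi (Gen.Xm i m) * gi (Gen.Xm j (n + 1))) -
          gi (Gen.Xm j (n + 1)) * gi (Gen.Xm i m))
  | serreP (i j : Idx M N) (m n k : ℤ) (h3 : 3 ≤ lvl)
      (h : cc M i.1 j.1 = 1 ∨ cc M i.1 j.1 = -1) (hi : i.1 ≠ M) :
      rel q M N ext lvl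
        (brF q (gi (Gen.Xp i m)) (brF q⁻¹ (gi (Gen.Xp i n)) (gi (Gen.Xp j k))) +
          brF q (gi (Gen.Xp i n)) (brF q⁻¹ (gi (Gen.Xp i m)) (gi (Gen.Xp j k)))) 0
  | serreM (i j : Idx M N) (m n k : ℤ) (h3 : 3 ≤ lvl)
      (h : cc M i.1 j.1 = 1 ∨ cc M i.1 j.1 = -1) (hi : i.1 ≠ M) :
      rel q M N ext lvl
        (brF q (gi (Gen.Xm i m)) (brF q⁻¹ (gi (Gen.Xm i n)) (gi (Gen.Xm j k))) +
          brF q (gi (Gen.Xm i n)) (brF q⁻¹ (gi (Gen.Xm i m)) (gi (Gen.Xm j k)))) 0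
  | oscP (m n k u : ℤ) (h3 : 3 ≤ lvl) (hM : 1 < M) (hN : 1 < N) :
      rel q M N ext lvl
        (oscOf q M (XpF M N ext) m n k u + oscOf q M (XpF M N ext) m u k n) 0
  | oscM (m n k u : ℤ) (h3 : 3 ≤ lvl) (hM : 1 < M) (hN : 1 < N) :
      rel q M N ext lvl
        (oscOf q M (XmF M N ext) m n k u + oscOf q M (XmF M N ext) m u k n) 0
  | K0K0i (he : ext = true) : rel q M N ext lvl (gi (Gen.K0 he) * gi (Gen.K0i he)) 1
  | K0iK0 (he : ext = true) : rel q M N ext lvl (gi (Gen.K0i he) * gi (Gen.K0 he)) 1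
  | K0K (he : ext = true) (i : Idx M N) :
      rel q M N ext lvl (gi (Gen.K0 he) * gi (Gen.K i)) (gi (Gen.K i) * gi (Gen.K0 he))
  | K0Ki (he : ext = true) (i : Idx M N) :
      rel q M N ext lvl (gi (Gen.K0 he) * gi (Gen.Ki i)) (gi (Gen.Ki i) * gi (Gen.K0 he))
  | K0H (he : ext = true) (i : Idx M N) (s : {s : ℤ // s ≠ 0}) :
      rel q M N ext lvl (gi (Gen.K0 he) * gi (Gen.H i s)) (gi (Gen.H i s) * gi (Gen.K0 he))
  | K0Xp (he : ext = true) (i : Idx M N) (n : ℤ) :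
      rel q M N ext lvl (gi (Gen.K0 he) * gi (Gen.Xp i n))
        ((q ^ (if i.1 = 1 then (1 : ℤ) else 0)) • (gi (Gen.Xp i n) * gi (Gen.K0 he)))
  | K0Xm (he : ext = true) (i : Idx M N) (n : ℤ) :
      rel q M N ext lvl (gi (Gen.K0 he) * gi (Gen.Xm i n))
        ((q ^ (if i.1 = 1 then (-1 : ℤ) else 0)) • (gi (Gen.Xm i n) * gi (Gen.K0 he)))

/-! ### The quantum affine superalgebras -/

abbrev ALG (q : ℂ) (M N : ℕ) (ext : Bool) (lvl : ℕ) := RingQuot (rel q M N ext lvl)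

def mkA (q : ℂ) (M N : ℕ) (ext : Bool) (lvl : ℕ) : FA M N ext →ₐ[ℂ] ALG q M N ext lvl :=
  RingQuot.mkAlgHom ℂ (rel q M N ext lvl)

def XpA (q : ℂ) (M N : ℕ) (ext : Bool) (lvl : ℕ) (i : ℕ) (n : ℤ) : ALG q M N ext lvl :=
  mkA q M N ext lvl (XpF M N ext i n)

def XmA (q : ℂ) (M N : ℕ) (ext : Bool) (lvl : ℕ) (i : ℕ) (n : ℤ) : ALG q M N ext lvl :=
  mkA q M N ext lvl (XmF M N ext i n)

def KA (q : ℂ) (M N : ℕ) (ext : Bool) (lvl : ℕ) (i : ℕ) : ALG q M N ext lvl :=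
  mkA q M N ext lvl (KF M N ext i)

def KiA (q : ℂ) (M N : ℕ) (ext : Bool) (lvl : ℕ) (i : ℕ) : ALG q M N ext lvl :=
  mkA q M N ext lvl (KiF M N ext i)

def HA (q : ℂ) (M N : ℕ) (ext : Bool) (lvl : ℕ) (i : ℕ) (s : ℤ) : ALG q M N ext lvl :=
  mkA q M N ext lvl (HF M N ext i s)

def K0A (q : ℂ) (M N : ℕ) (ext : Bool) (lvl : ℕ) : ALG q M N ext lvl :=
  mkA q M N ext lvl (K0F M N ext)

def K0iA (q : ℂ) (M N : ℕ) (ext : Bool) (lvl : ℕ) : ALG q M N ext lvl :=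
  mkA q M N ext lvl (K0iF M N ext)

def phiPA (q : ℂ) (M N : ℕ) (ext : Bool) (lvl : ℕ) (i : ℕ) (n : ℤ) : ALG q M N ext lvl :=
  mkA q M N ext lvl (phiPF q M N ext i n)

def phiMA (q : ℂ) (M N : ℕ) (ext : Bool) (lvl : ℕ) (i : ℕ) (n : ℤ) : ALG q M N ext lvl :=
  mkA q M N ext lvl (phiMF q M N ext i n)

/-- `U⁺`: the subalgebra generated by the `X⁺_{i,n}`. -/
def Aplus (q : ℂ) (M N : ℕ) (ext : Bool) (lvl : ℕ) : Subalgebra ℂ (ALG q M N ext lvl) :=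
  Algebra.adjoin ℂ {x | ∃ i : ℕ, ∃ n : ℤ, x = XpA q M N ext lvl i n}

/-- `U⁻`: the subalgebra generated by the `X⁻_{i,n}`. -/
def Aminus (q : ℂ) (M N : ℕ) (ext : Bool) (lvl : ℕ) : Subalgebra ℂ (ALG q M N ext lvl) :=
  Algebra.adjoin ℂ {x | ∃ i : ℕ, ∃ n : ℤ, x = XmA q M N ext lvl i n}

/-- `U⁰`: the subalgebra generated by the `K_i^{±1}` and `h_{i,s}`. -/
def Azero (q : ℂ) (M N : ℕ) (ext : Bool) (lvl : ℕ) : Subalgebra ℂ (ALG q M N ext lvl) :=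
  Algebra.adjoin ℂ {x | (∃ i : ℕ, x = KA q M N ext lvl i) ∨ (∃ i : ℕ, x = KiA q M N ext lvl i) ∨
    ∃ i : ℕ, ∃ s : ℤ, x = HA q M N ext lvl i s}

/-- `U'⁰`: the subalgebra generated by `U⁰` and `K₀^{±1}`. -/
def AzeroE (q : ℂ) (M N : ℕ) (ext : Bool) (lvl : ℕ) : Subalgebra ℂ (ALG q M N ext lvl) :=
  Algebra.adjoin ℂ {x | (∃ i : ℕ, x = KA q M N ext lvl i) ∨ (∃ i : ℕ, x = KiA q M N ext lvl i) ∨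
    (∃ i : ℕ, ∃ s : ℤ, x = HA q M N ext lvl i s) ∨ x = K0A q M N ext lvl ∨
      x = K0iA q M N ext lvl}

/-! ### The multiplication map on the triple tensor product -/

def triMul (q : ℂ) (M N : ℕ) (ext : Bool) (lvl : ℕ)
    (S T R : Subalgebra ℂ (ALG q M N ext lvl)) :
    (↥S ⊗[ℂ] (↥T ⊗[ℂ] ↥R)) →ₗ[ℂ] ALG q M N ext lvl :=
  TensorProduct.lift
    (((LinearMap.mul ℂ (ALG q M N ext lvl)).comp S.val.toLinearMap).compl₂
      (TensorProduct.lift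
        (((LinearMap.mul ℂ (ALG q M N ext lvl)).comp T.val.toLinearMap).compl₂
          R.val.toLinearMap)))

/-! ### Root vectors and PBW monomials -/

def Xroot (q : ℂ) (M N : ℕ) (ext : Bool) (lvl : ℕ) (i : ℕ) : ℕ → ℤ → ALG q M N ext lvl
  | 0, n => XpA q M N ext lvl i n
  | k + 1, n =>
      brF (qpar q M (i + k + 1)) (Xroot q M N ext lvl i k n) (XpA q M N ext lvl (i + k + 1) 0)

/-- the root vector `X_{α_i + ⋯ + α_j}(n)`. -/
def XrootIJ (q : ℂ) (M N : ℕ) (ext : Bool) (lvl : ℕ) (i j : ℕ) (n : ℤ) : ALG q M N ext lvl :=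
  Xroot q M N ext lvl i (j - i) n

def rootLE (a b : ℕ × ℕ) : Prop := a.1 < b.1 ∨ (a.1 = b.1 ∧ a.2 ≤ b.2)

/-- the set of PBW ordered monomials in the root vectors. -/
def pbwSet (q : ℂ) (M N : ℕ) (ext : Bool) (lvl : ℕ) : Set (ALG q M N ext lvl) :=
  {x | ∃ L : List ((ℕ × ℕ) × ℤ),
      (∀ p ∈ L, 1 ≤ p.1.1 ∧ p.1.1 ≤ p.1.2 ∧ p.1.2 ≤ M + N - 1) ∧
      L.Chain' (fun a b => rootLE a.1 b.1) ∧
      x = (L.map fun p => XrootIJ q M N ext lvl p.1.1 p.1.2 p.2).prod}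

/-- PBW ordered monomials of total degree `d` (`d i` counts the multiplicity of `α_i`). -/
def pbwDegSet (q : ℂ) (M N : ℕ) (ext : Bool) (lvl : ℕ) (d : ℕ → ℕ) : Set (ALG q M N ext lvl) :=
  {x | ∃ L : List ((ℕ × ℕ) × ℤ),
      (∀ p ∈ L, 1 ≤ p.1.1 ∧ p.1.1 ≤ p.1.2 ∧ p.1.2 ≤ M + N - 1) ∧
      L.Chain' (fun a b => rootLE a.1 b.1) ∧
      (∀ i : ℕ, ((L.map fun p => if p.1.1 ≤ i ∧ i ≤ p.1.2 then 1 else 0).sum) = d i) ∧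
      x = (L.map fun p => XrootIJ q M N ext lvl p.1.1 p.1.2 p.2).prod}

/-- words in the generators `X⁺_{i,n}` of degree `d`. -/
def wordDegSet (q : ℂ) (M N : ℕ) (ext : Bool) (lvl : ℕ) (d : ℕ → ℕ) :
    Set (ALG q M N ext lvl) :=
  {x | ∃ w : List (ℕ × ℤ), (∀ p ∈ w, 1 ≤ p.1 ∧ p.1 ≤ M + N - 1) ∧
      (∀ i : ℕ, (w.map Prod.fst).count i = d i) ∧
      x = (w.map fun p => XpA q M N ext lvl p.1 p.2).prod}

/-! ### The subspaces `I^±_{i,j}` and `O^±` -/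

def IElt (q : ℂ) (M N : ℕ) (ext : Bool) (lvl : ℕ) (pl : Bool) (i j : ℕ) (m n : ℤ) :
    ALG q M N ext lvl :=
  let X : ℕ → ℤ → ALG q M N ext lvl := if pl then XpA q M N ext lvl else XmA q M N ext lvl
  let e : ℤ := if pl then cc M i j else -cc M i j
  if cc M i j = 0 then X i m * X j n - sgn M i j • (X j n * X i m)
  else
    X i (m + 1) * X j n - (q ^ e) • (X j n * X i (m + 1)) -
      (q ^ e) • (X i m * X j (n + 1)) + X j (n + 1) * X i m

def Isub (q : ℂ) (M N : ℕ) (ext : Bool) (lvl : ℕ) (pl : Bool) (i j : ℕ) :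
    Submodule ℂ (ALG q M N ext lvl) :=
  Submodule.span ℂ (Set.range fun p : ℤ × ℤ => IElt q M N ext lvl pl i j p.1 p.2)

def IsubAll (q : ℂ) (M N : ℕ) (ext : Bool) (lvl : ℕ) (pl : Bool) :
    Submodule ℂ (ALG q M N ext lvl) :=
  ⨆ p : ℕ × ℕ, ⨆ _ : 1 ≤ p.1 ∧ p.1 ≤ p.2 ∧ p.2 ≤ M + N - 1,
    Isub q M N ext lvl pl p.1 p.2

def OscElt (q : ℂ) (M N : ℕ) (ext : Bool) (lvl : ℕ) (pl : Bool) (m n k u : ℤ) :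
    ALG q M N ext lvl :=
  let X : ℕ → ℤ → ALG q M N ext lvl := if pl then XpA q M N ext lvl else XmA q M N ext lvl
  oscOf q M X m n k u + oscOf q M X m u k n

def Osub (q : ℂ) (M N : ℕ) (ext : Bool) (lvl : ℕ) (pl : Bool) :
    Submodule ℂ (ALG q M N ext lvl) :=
  Submodule.span ℂ
    (Set.range fun p : ℤ × ℤ × ℤ × ℤ => OscElt q M N ext lvl pl p.1 p.2.1 p.2.2.1 p.2.2.2)

/-- the sign `(−1)^{(p(α_k)+p(α_u))·p(α_i)}`. -/
def gsgn (M : ℕ) (k u i : ℕ) : ℂ :=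
  if ((k = M ∧ ¬u = M) ∨ (¬k = M ∧ u = M)) ∧ i = M then -1 else 1

/-! ### Highest weights and the associated eigenvalue sequences -/

/-- `Q·f = 0` for a bilateral formal series `f`. -/
def annih (Q : Polynomial ℂ) (f : ℤ → ℂ) : Prop :=
  ∀ n : ℤ, ∑ s ∈ Finset.range (Q.natDegree + 1), Q.coeff s * f (n - s) = 0

/-- an element of `R_{M,N}`: a highest weight `(P̲, f, c)`. -/
structure HW (q : ℂ) (M N : ℕ) : Type where
  P : ℕ → Polynomial ℂ
  f : ℤ → ℂ
  c : ℂ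
  P_const : ∀ i, (P i).coeff 0 = 1
  c_ne : c ≠ 0
  torsion : ∃ Q : Polynomial ℂ, Q ≠ 0 ∧ annih Q f
  f_zero : f 0 = (c - c⁻¹) / (q - q⁻¹)

def toPS (p : Polynomial ℂ) : PowerSeries ℂ := PowerSeries.mk fun n => p.coeff n

/-- `P(z·u)`. -/
def pscale (u : ℂ) (P : Polynomial ℂ) : Polynomial ℂ := P.comp (Polynomial.C u * Polynomial.X)

/-- the coefficient of `z^n` (`n ≥ 0`) in `q_i^{deg P} P(z q_i⁻¹)/P(z q_i)`,
expanded at `z = 0`. -/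
def gammaP (q : ℂ) (M : ℕ) (i : ℕ) (P : Polynomial ℂ) (n : ℤ) : ℂ :=
  if 0 ≤ n then
    qpar q M i ^ P.natDegree *
      PowerSeries.coeff n.toNat
        (toPS (pscale (qpar q M i)⁻¹ P) * (toPS (pscale (qpar q M i) P))⁻¹)
  else 0

/-- the coefficient of `z^n` (`n ≤ 0`) in `q_i^{deg P} P(z q_i⁻¹)/P(z q_i)`,
expanded at `z = ∞`. -/
def gammaM (q : ℂ) (M : ℕ) (i : ℕ) (P : Polynomial ℂ) (n : ℤ) : ℂ :=
  if n ≤ 0 then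
    qpar q M i ^ P.natDegree *
      PowerSeries.coeff (-n).toNat
        (toPS ((pscale (qpar q M i)⁻¹ P).reflect P.natDegree) *
          (toPS ((pscale (qpar q M i) P).reflect P.natDegree))⁻¹)
  else 0

/-! ### Verma, Weyl and simple modules -/

def vermaRels (q : ℂ) (M N : ℕ) (ext : Bool) (Λ : HW q M N) : Set (ALG q M N ext 3) :=
  {x | ∃ i : ℕ, ∃ n : ℤ, x = XpA q M N ext 3 i n} ∪
  {x | ∃ i : ℕ, ∃ n : ℤ, 1 ≤ i ∧ i ≤ M + N - 1 ∧ i ≠ M ∧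
      (x = phiPA q M N ext 3 i n - algebraMap ℂ _ (gammaP q M i (Λ.P i) n) ∨
       x = phiMA q M N ext 3 i n - algebraMap ℂ _ (gammaM q M i (Λ.P i) n))} ∪
  {x | x = KA q M N ext 3 M - algebraMap ℂ _ Λ.c} ∪
  {x | ∃ n : ℤ, x = phiPA q M N ext 3 M n - phiMA q M N ext 3 M n -
      algebraMap ℂ _ ((q - q⁻¹) * Λ.f n)} ∪
  {x | ext = true ∧ x = K0A q M N ext 3 - 1}

def evenRels (q : ℂ) (M N : ℕ) (ext : Bool) (Λ : HW q M N) : Set (ALG q M N ext 3) :=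
  {x | ∃ i : ℕ, 1 ≤ i ∧ i ≤ M + N - 1 ∧ i ≠ M ∧
      x = XmA q M N ext 3 i 0 ^ (1 + (Λ.P i).natDegree)}

def oddElt (q : ℂ) (M N : ℕ) (ext : Bool) (Q : Polynomial ℂ) (n : ℤ) : ALG q M N ext 3 :=
  ∑ s ∈ Finset.range (Q.natDegree + 1),
    Q.coeff (Q.natDegree - s) • XmA q M N ext 3 M ((s : ℤ) + n)

def oddRels (q : ℂ) (M N : ℕ) (ext : Bool) (Q : Polynomial ℂ) : Set (ALG q M N ext 3) :=
  if M = 1 ∧ N = 1 then {x | ∃ n : ℤ, x = oddElt q M N ext Q n}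
  else {oddElt q M N ext Q 0}

def vermaIdeal (q : ℂ) (M N : ℕ) (ext : Bool) (Λ : HW q M N) : Ideal (ALG q M N ext 3) :=
  Ideal.span (vermaRels q M N ext Λ)

def weylIdeal (q : ℂ) (M N : ℕ) (ext : Bool) (Λ : HW q M N) (Q : Polynomial ℂ) :
    Ideal (ALG q M N ext 3) :=
  Ideal.span (vermaRels q M N ext Λ ∪ evenRels q M N ext Λ ∪ oddRels q M N ext Q)

def uweylIdeal (q : ℂ) (M N : ℕ) (ext : Bool) (Λ : HW q M N) : Ideal (ALG q M N ext 3) :=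
  Ideal.span (vermaRels q M N ext Λ ∪ evenRels q M N ext Λ)

/-- the Verma module `M(Λ)`. -/
def VermaMod (q : ℂ) (M N : ℕ) (ext : Bool) (Λ : HW q M N) : Type :=
  ALG q M N ext 3 ⧸ vermaIdeal q M N ext Λ

/-- the Weyl module `W(Λ; Q)`. -/
def WeylMod (q : ℂ) (M N : ℕ) (ext : Bool) (Λ : HW q M N) (Q : Polynomial ℂ) : Type :=
  ALG q M N ext 3 ⧸ weylIdeal q M N ext Λ Q

/-- the universal Weyl module `W(Λ)`. -/
def UWeylMod (q : ℂ) (M N : ℕ) (ext : Bool) (Λ : HW q M N) : Type :=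
  ALG q M N ext 3 ⧸ uweylIdeal q M N ext Λ

instance (q : ℂ) (M N : ℕ) (ext : Bool) (Λ : HW q M N) : AddCommGroup (VermaMod q M N ext Λ) :=
  inferInstanceAs (AddCommGroup (ALG q M N ext 3 ⧸ vermaIdeal q M N ext Λ))
instance (q : ℂ) (M N : ℕ) (ext : Bool) (Λ : HW q M N) :
    Module (ALG q M N ext 3) (VermaMod q M N ext Λ) :=
  inferInstanceAs (Module (ALG q M N ext 3) (ALG q M N ext 3 ⧸ vermaIdeal q M N ext Λ))
instance (q : ℂ) (M N : ℕ) (ext : Bool) (Λ : HW q M N) : Module ℂ (VermaMod q M N ext Λ) :=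
  inferInstanceAs (Module ℂ (ALG q M N ext 3 ⧸ vermaIdeal q M N ext Λ))
instance (q : ℂ) (M N : ℕ) (ext : Bool) (Λ : HW q M N) :
    IsScalarTower ℂ (ALG q M N ext 3) (VermaMod q M N ext Λ) :=
  inferInstanceAs (IsScalarTower ℂ (ALG q M N ext 3) (ALG q M N ext 3 ⧸ vermaIdeal q M N ext Λ))

instance (q : ℂ) (M N : ℕ) (ext : Bool) (Λ : HW q M N) (Q : Polynomial ℂ) :
    AddCommGroup (WeylMod q M N ext Λ Q) :=
  inferInstanceAs (AddCommGroup (ALG q M N ext 3 ⧸ weylIdeal q M N ext Λ Q))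
instance (q : ℂ) (M N : ℕ) (ext : Bool) (Λ : HW q M N) (Q : Polynomial ℂ) :
    Module (ALG q M N ext 3) (WeylMod q M N ext Λ Q) :=
  inferInstanceAs (Module (ALG q M N ext 3) (ALG q M N ext 3 ⧸ weylIdeal q M N ext Λ Q))
instance (q : ℂ) (M N : ℕ) (ext : Bool) (Λ : HW q M N) (Q : Polynomial ℂ) :
    Module ℂ (WeylMod q M N ext Λ Q) :=
  inferInstanceAs (Module ℂ (ALG q M N ext 3 ⧸ weylIdeal q M N ext Λ Q))
instance (q : ℂ) (M N : ℕ) (ext : Bool) (Λ : HW q M N) (Q : Polynomial ℂ) :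
    IsScalarTower ℂ (ALG q M N ext 3) (WeylMod q M N ext Λ Q) :=
  inferInstanceAs
    (IsScalarTower ℂ (ALG q M N ext 3) (ALG q M N ext 3 ⧸ weylIdeal q M N ext Λ Q))

instance (q : ℂ) (M N : ℕ) (ext : Bool) (Λ : HW q M N) : AddCommGroup (UWeylMod q M N ext Λ) :=
  inferInstanceAs (AddCommGroup (ALG q M N ext 3 ⧸ uweylIdeal q M N ext Λ))
instance (q : ℂ) (M N : ℕ) (ext : Bool) (Λ : HW q M N) :
    Module (ALG q M N ext 3) (UWeylMod q M N ext Λ) :=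
  inferInstanceAs (Module (ALG q M N ext 3) (ALG q M N ext 3 ⧸ uweylIdeal q M N ext Λ))
instance (q : ℂ) (M N : ℕ) (ext : Bool) (Λ : HW q M N) : Module ℂ (UWeylMod q M N ext Λ) :=
  inferInstanceAs (Module ℂ (ALG q M N ext 3 ⧸ uweylIdeal q M N ext Λ))
instance (q : ℂ) (M N : ℕ) (ext : Bool) (Λ : HW q M N) :
    IsScalarTower ℂ (ALG q M N ext 3) (UWeylMod q M N ext Λ) :=
  inferInstanceAs (IsScalarTower ℂ (ALG q M N ext 3) (ALG q M N ext 3 ⧸ uweylIdeal q M N ext Λ))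

/-- the highest weight vector (image of `1`). -/
def vgen (q : ℂ) (M N : ℕ) (Λ : HW q M N) : VermaMod q M N true Λ :=
  Submodule.Quotient.mk 1

/-- the sum of all submodules not containing the highest weight vector (the unique
maximal submodule of the Verma module). -/
def radV (q : ℂ) (M N : ℕ) (Λ : HW q M N) :
    Submodule (ALG q M N true 3) (VermaMod q M N true Λ) :=
  sSup {p | vgen q M N Λ ∉ p}

/-- the simple quotient `S'(Λ)`. -/
def SimpMod (q : ℂ) (M N : ℕ) (Λ : HW q M N) : Type :=
  VermaMod q M N true Λ ⧸ radV q M N Λ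

instance (q : ℂ) (M N : ℕ) (Λ : HW q M N) : AddCommGroup (SimpMod q M N Λ) :=
  inferInstanceAs (AddCommGroup (VermaMod q M N true Λ ⧸ radV q M N Λ))
instance (q : ℂ) (M N : ℕ) (Λ : HW q M N) :
    Module (ALG q M N true 3) (SimpMod q M N Λ) :=
  inferInstanceAs (Module (ALG q M N true 3) (VermaMod q M N true Λ ⧸ radV q M N Λ))
instance (q : ℂ) (M N : ℕ) (Λ : HW q M N) : Module ℂ (SimpMod q M N Λ) :=
  inferInstanceAs (Module ℂ (VermaMod q M N true Λ ⧸ radV q M N Λ))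
instance (q : ℂ) (M N : ℕ) (Λ : HW q M N) :
    IsScalarTower ℂ (ALG q M N true 3) (SimpMod q M N Λ) :=
  inferInstanceAs (IsScalarTower ℂ (ALG q M N true 3) (VermaMod q M N true Λ ⧸ radV q M N Λ))

/-! ### Weight spaces -/

/-- `K_i` for `0 ≤ i`, with `K₀` at `i = 0`. -/
def Kgen (q : ℂ) (M N : ℕ) (ext : Bool) (lvl : ℕ) (i : ℕ) : ALG q M N ext lvl :=
  if i = 0 then K0A q M N ext lvl else KA q M N ext lvl i

/-- the `μ`-weight space of a module. -/
def wtSp (q : ℂ) (M N : ℕ) (ext : Bool) {W : Type} [AddCommGroup W] [Module ℂ W]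
    [Module (ALG q M N ext 3) W] [IsScalarTower ℂ (ALG q M N ext 3) W] (μ : ℕ → ℂ) :
    Submodule ℂ W where
  carrier := {w | ∀ i < M + N, Kgen q M N ext 3 i • w = μ i • w}
  add_mem' := by
    intro a b ha hb i hi
    rw [smul_add, ha i hi, hb i hi, smul_add]
  zero_mem' := by
    intro i hi
    rw [smul_zero, smul_zero]
  smul_mem' := by
    intro c w hw i hi
    have h1 : Kgen q M N ext 3 i • (c • w) = c • (Kgen q M N ext 3 i • w) := by
      rw [← algebraMap_smul (ALG q M N ext 3) c w, ← mul_smul, ← Algebra.commutes, mul_smul,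
        algebraMap_smul]
    rw [h1, hw i hi, smul_comm]

/-- the character `λ_Λ`. -/
def lamF (q : ℂ) (M N : ℕ) (Λ : HW q M N) : ℕ → ℂ :=
  fun i => if i = 0 then 1 else if i = M then Λ.c else qpar q M i ^ (Λ.P i).natDegree

/-- the character `α_j`. -/
def alF (q : ℂ) (M : ℕ) (j : ℕ) : ℕ → ℂ :=
  fun i => if i = 0 then (if j = 1 then q else 1) else q ^ cc M j i

/-! ### The generators of `U` inside `U'` -/

def UGenSet (q : ℂ) (M N : ℕ) : Set (ALG q M N true 3) :=
  {x | (∃ i : ℕ, ∃ n : ℤ, x = XpA q M N true 3 i n) ∨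
    (∃ i : ℕ, ∃ n : ℤ, x = XmA q M N true 3 i n) ∨
    (∃ i : ℕ, x = KA q M N true 3 i) ∨ (∃ i : ℕ, x = KiA q M N true 3 i) ∨
    ∃ i : ℕ, ∃ s : ℤ, x = HA q M N true 3 i s}

/-! ### One-sided presentations (for `U^±`) -/

def XgF (M N : ℕ) (i : ℕ) (n : ℤ) : FreeAlgebra ℂ (Idx M N × ℤ) :=
  if h : 1 ≤ i ∧ i ≤ M + N - 1 then FreeAlgebra.ι ℂ ((⟨i, h⟩, n) : Idx M N × ℤ) else 0

inductive rel1 (q : ℂ) (M N : ℕ) (pl : Bool) :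
    FreeAlgebra ℂ (Idx M N × ℤ) → FreeAlgebra ℂ (Idx M N × ℤ) → Prop
  | comm0 (i j : Idx M N) (m n : ℤ) (h : cc M i.1 j.1 = 0) :
      rel1 q M N pl
        (FreeAlgebra.ι ℂ ((i, m) : Idx M N × ℤ) * FreeAlgebra.ι ℂ ((j, n) : Idx M N × ℤ) -
          sgn M i.1 j.1 •
            (FreeAlgebra.ι ℂ ((j, n) : Idx M N × ℤ) * FreeAlgebra.ι ℂ ((i, m) : Idx M N × ℤ))) 0
  | deg2 (i j : Idx M N) (m n : ℤ) (h : cc M i.1 j.1 ≠ 0) :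
      rel1 q M N pl
        (FreeAlgebra.ι ℂ ((i, m + 1) : Idx M N × ℤ) * FreeAlgebra.ι ℂ ((j, n) : Idx M N × ℤ) -
          (q ^ (if pl then cc M i.1 j.1 else -cc M i.1 j.1)) •
            (FreeAlgebra.ι ℂ ((j, n) : Idx M N × ℤ) *
              FreeAlgebra.ι ℂ ((i, m + 1) : Idx M N × ℤ)))
        ((q ^ (if pl then cc M i.1 j.1 else -cc M i.1 j.1)) •
            (FreeAlgebra.ι ℂ ((i, m) : Idx M N × ℤ) *
              FreeAlgebra.ι ℂ ((j, n + 1) : Idx M N × ℤ)) -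
          FreeAlgebra.ι ℂ ((j, n + 1) : Idx M N × ℤ) * FreeAlgebra.ι ℂ ((i, m) : Idx M N × ℤ))
  | serre (i j : Idx M N) (m n k : ℤ) (h : cc M i.1 j.1 = 1 ∨ cc M i.1 j.1 = -1)
      (hi : i.1 ≠ M) :
      rel1 q M N pl
        (brF q (FreeAlgebra.ι ℂ ((i, m) : Idx M N × ℤ))
            (brF q⁻¹ (FreeAlgebra.ι ℂ ((i, n) : Idx M N × ℤ))
              (FreeAlgebra.ι ℂ ((j, k) : Idx M N × ℤ))) +
          brF q (FreeAlgebra.ι ℂ ((i, n) : Idx M N × ℤ))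
            (brF q⁻¹ (FreeAlgebra.ι ℂ ((i, m) : Idx M N × ℤ))
              (FreeAlgebra.ι ℂ ((j, k) : Idx M N × ℤ)))) 0
  | osc (m n k u : ℤ) (hM : 1 < M) (hN : 1 < N) :
      rel1 q M N pl (oscOf q M (XgF M N) m n k u + oscOf q M (XgF M N) m u k n) 0

end QAS

namespace QASProof

/-- geometric sum -/
def gs (p : ℂ) : ℕ → ℂ
  | 0 => 0
  | n + 1 => 1 + p * gs p n

theorem gs_mul (p : ℂ) (n : ℕ) : (1 - p) * gs p n = 1 - p ^ n := by
  induction n with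
  | zero => simp [gs]
  | succ n ih =>
    simp only [gs]
    linear_combination p * ih

theorem gs_inv (p P : ℂ) (h : p * P = 1) (n : ℕ) : p ^ n * gs P (n + 1) = gs p (n + 1) := by
  by_cases hp : p = 1
  · subst hp
    have : P = 1 := by simpa using h
    subst this
    simp
  · have h1 := gs_mul p (n + 1)
    have h2 := gs_mul P (n + 1)
    have hp' : 1 - p ≠ 0 := fun h => hp (by linear_combination -h)
    apply mul_left_cancel₀ hp'
    have h3 : p ^ (n + 1) * P ^ (n + 1) = 1 := by rw [← mul_pow, h, one_pow]
    rw [h1]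
    have h4 : (1 - p) * (p ^ n * gs P (n + 1)) = - (p ^ (n + 1) * ((1 - P) * gs P (n + 1))) := by
      have : p ^ (n + 1) = p ^ n * p := pow_succ _ _
      rw [this]
      linear_combination (- p ^ n * gs P (n + 1)) * h
    rw [h4, h2]
    linear_combination h3

section ring
variable {A : Type*} [Ring A] [Algebra ℂ A]

theorem y_pow (a y : A) (p : ℂ) (hya : y * a = p • (a * y)) (n : ℕ) :
    y * a ^ n = p ^ n • (a ^ n * y) := by
  induction n with
  | zero => simp
  | succ n ih =>
    rw [pow_succ, ← mul_assoc, ih, smul_mul_assoc, mul_assoc, hya, mul_smul_comm, smul_smul,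
      ← mul_assoc, pow_succ]

theorem h_pow (a y h : A) (p : ℂ) (hya : y * a = p • (a * y)) (hha : h * a = a * h + y) (n : ℕ) :
    h * a ^ (n + 1) = a ^ (n + 1) * h + gs p (n + 1) • (a ^ n * y) := by
  induction n with
  | zero => simp [gs, hha]
  | succ n ih =>
    rw [pow_succ a (n + 1), ← mul_assoc, ih, add_mul, mul_assoc, hha, smul_mul_assoc, mul_assoc, hya,
      mul_add, mul_smul_comm, ← mul_assoc (a ^ n) a y, ← mul_assoc (a ^ (n + 1)) a h, ← pow_succ a n]
    rw [show gs p (n + 1 + 1) = 1 + p * gs p (n + 1) from rfl]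
    module

theorem garlandLem (a b h K y : A) (p : ℂ) (hab : b * a = a * b + K * h) (hKh : K * h = h * K)
    (hKa : K * a = p • (a * K)) (hya : y * a = p • (a * y)) (hha : h * a = a * h + y) (n : ℕ) :
    (1 + p) • (b * a ^ (n + 1)) = (1 + p) • (a ^ (n + 1) * b) +
      gs p (n + 1) • ((a ^ n * h + p • (h * a ^ n)) * K) := by
  induction n with
  | zero =>
    simp [gs, hab, hKh, add_mul]
    module
  | succ n ih =>
    have e1 : (1 + p) • (b * a ^ (n + 1 + 1)) = ((1 + p) • (b * a ^ (n + 1))) * a := by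
      rw [pow_succ a (n + 1), smul_mul_assoc, mul_assoc]
    have hhn : h * a ^ n * a = a ^ (n + 1) * h + gs p (n + 1) • (a ^ n * y) := by
      rw [mul_assoc, ← pow_succ, h_pow a y h p hya hha]
    have hhn1 : h * a ^ (n + 1) = a ^ (n + 1) * h + gs p (n + 1) • (a ^ n * y) :=
      h_pow a y h p hya hha n
    rw [e1, ih, add_mul, smul_mul_assoc, smul_mul_assoc, mul_assoc (a ^ (n + 1)) b a, hab,
      mul_assoc _ K a, hKa, mul_smul_comm, ← mul_assoc _ a K, add_mul (a ^ n * h), mul_assoc (a ^ n) h a,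
      hha, smul_mul_assoc p, hhn, hhn1, hKh, mul_add, mul_add, ← mul_assoc _ a b, ← mul_assoc _ a h,
      ← pow_succ, ← pow_succ, ← mul_assoc _ h K]
    rw [show gs p (n + 1 + 1) = 1 + p * gs p (n + 1) from rfl]
    simp only [add_mul, smul_mul_assoc, smul_add, smul_smul]
    module
end ring

/-- the solution of `φ u = k u(p z)` -/
def useq (g : ℕ → ℂ) (k p : ℂ) : ℕ → ℂ
  | 0 => 1
  | n + 1 => (k * (p ^ (n + 1) - 1))⁻¹ * ∑ j ∈ Finset.range (n + 1), g (j + 1) * useq g k p (n - j)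
termination_by n => n
decreasing_by omega

theorem useq_rec (g : ℕ → ℂ) (k p : ℂ) (hk : k ≠ 0) (hp : ∀ n : ℕ, n ≠ 0 → p ^ n ≠ 1) (n : ℕ) :
    k * (p ^ (n + 1) - 1) * useq g k p (n + 1) =
      ∑ j ∈ Finset.range (n + 1), g (j + 1) * useq g k p (n - j) := by
  rw [useq, mul_inv_cancel_left₀]
  exact mul_ne_zero hk (sub_ne_zero.mpr (hp _ (by omega)))

/-- product of the `gs` -/
def gf (p : ℂ) : ℕ → ℂ
  | 0 => 1
  | n + 1 => gf p n * gs p (n + 1)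

theorem gs_ne (p : ℂ) (hp : ∀ n : ℕ, n ≠ 0 → p ^ n ≠ 1) (n : ℕ) : gs p (n + 1) ≠ 0 := by
  intro h
  have := gs_mul p (n + 1)
  rw [h] at this
  exact hp (n + 1) (by omega) (by linear_combination this)

theorem gf_ne (p : ℂ) (hp : ∀ n : ℕ, n ≠ 0 → p ^ n ≠ 1) (n : ℕ) : gf p n ≠ 0 := by
  induction n with
  | zero => simp [gf]
  | succ n ih => exact mul_ne_zero ih (gs_ne p hp n)

section mod
variable {V : Type*} [AddCommGroup V] [Module ℂ V]

theorem pow_weight (K F : Module.End ℂ V) (p k : ℂ) (v : V) (hKF : K * F = p • (F * K))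
    (hv : K v = k • v) (n : ℕ) : K ((F ^ n) v) = (k * p ^ n) • (F ^ n) v := by
  have := y_pow F K p hKF n
  have h2 := congrArg (fun f : Module.End ℂ V => f v) this
  simp only [Module.End.mul_apply, LinearMap.smul_apply, hv, map_smul] at h2
  rw [h2, smul_smul, mul_comm]

theorem garland_step (E F h K x2 y1 : Module.End ℂ V) (q k l : ℂ) (v : V)
    (hq : q ≠ 0)
    (hEF : E * F = F * E + K * h) (hKh : K * h = h * K)
    (hKF : K * F = (q⁻¹ ^ 2) • (F * K)) (hKE : K * E = (q ^ 2) • (E * K))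
    (hhF : h * F = F * h - (q + q⁻¹) • x2) (hhE : h * E = E * h + (q + q⁻¹) • y1)
    (hx : x2 * F = (q⁻¹ ^ 2) • (F * x2)) (hy : y1 * E = (q ^ 2) • (E * y1))
    (hEv : E v = 0) (hKv : K v = k • v) (hhv : h v = l • v) (n : ℕ) :
    (1 + q⁻¹ ^ 2) • (E ^ (n + 1)) ((F ^ (n + 2)) v) =
      gs (q⁻¹ ^ 2) (n + 2) • ((1 + q⁻¹ ^ 2) • F ((E ^ (n + 1)) ((F ^ (n + 1)) v)) +
        (k * q⁻¹ ^ 2 * gs (q⁻¹ ^ 2) (n + 1)) • (h ((E ^ n) ((F ^ (n + 1)) v)) -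
          l • (E ^ n) ((F ^ (n + 1)) v))) := by
  set p : ℂ := q⁻¹ ^ 2 with hp
  have hpq : p * q ^ 2 = 1 := by rw [hp]; field_simp
  have hI := garlandLem F E h K (-((q + q⁻¹) • x2)) p hEF hKh hKF
    (by rw [neg_mul, smul_mul_assoc, hx]; simp only [mul_neg, mul_smul_comm]; module)
    (by rw [hhF]; abel) (n + 1)
  have hII := garlandLem E F (-h) K (-((q + q⁻¹) • y1)) (q ^ 2) (by rw [hEF]; simp) (by simp [hKh]) hKE
    (by rw [neg_mul, smul_mul_assoc, hy]; simp only [mul_neg, mul_smul_comm]; module)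
    (by rw [neg_mul, hhE]; simp; abel) n
  have hI' := congrArg (fun f : Module.End ℂ V => (E ^ n) (f v)) hI
  have hII' := congrArg (fun f : Module.End ℂ V => f ((F ^ (n + 1)) v)) hII
  have hw := pow_weight K F p k v hKF hKv (n + 1)
  simp only [Module.End.mul_apply, LinearMap.smul_apply, LinearMap.add_apply, hEv, map_zero,
    smul_zero, zero_add, hKv, map_smul, hhv, map_add, hw, LinearMap.neg_apply, map_neg] at hI' hII'
  have eE : (E ^ n) (E ((F ^ (n + 1 + 1)) v)) = (E ^ (n + 1)) ((F ^ (n + 2)) v) := by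
    rw [pow_succ E n]; rfl
  have eF : (E ^ (n + 1)) (F ((F ^ (n + 1)) v)) = (E ^ (n + 1)) ((F ^ (n + 2)) v) := by
    rw [pow_succ' F (n + 1)]; rfl
  rw [eE] at hI'
  rw [eF] at hII'
  set Y := (E ^ (n + 1)) ((F ^ (n + 2)) v)
  set y := (E ^ n) ((F ^ (n + 1)) v)
  set z := (E ^ n) (h ((F ^ (n + 1)) v))
  set w := F ((E ^ (n + 1)) ((F ^ (n + 1)) v))
  have hgs := gs_inv p (q ^ 2) hpq n
  have hgs2 : gs p (n + 2) = 1 + p * gs p (n + 1) := rfl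
  have hII2 : (1 + p) • Y = (1 + p) • w + (gs p (n + 1) * k * p) • (p • z + h y) := by
    have h3 := congrArg (fun x => p • x) hII'
    have a1 : p * (1 + q ^ 2) = 1 + p := by linear_combination hpq
    rw [smul_smul, a1, smul_add, smul_smul, a1] at h3
    have a2 : p * gs (q ^ 2) (n + 1) * (k * p ^ (n + 1)) = p * p * k * gs p (n + 1) := by
      rw [← hgs]; ring
    have h4 : (1 + p) • Y = (1 + p) • w + (p * gs (q ^ 2) (n + 1) * (k * p ^ (n + 1))) • z
        + (p * gs (q ^ 2) (n + 1) * (k * p ^ (n + 1)) * q ^ 2) • h y := by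
      rw [h3]; module
    rw [h4, a2]
    have a3 : p * p * k * gs p (n + 1) * q ^ 2 = p * k * gs p (n + 1) := by
      linear_combination (p * k * gs p (n + 1)) * hpq
    rw [a3]; module
  have hI2 : (1 + p) • Y = (gs p (n + 2) * k) • (l • y + p • z) := by
    rw [hI']; module
  have key : (1 + p) • Y = gs p (n + 2) • ((1 + p) • Y) - (p * gs p (n + 1)) • ((1 + p) • Y) := by
    rw [hgs2]; module
  rw [key]
  nth_rewrite 1 [hII2]
  rw [hI2]
  module

end mod
end QASProof

namespace QASProof
section mod2
variable {V : Type*} [AddCommGroup V] [Module ℂ V]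

theorem garland_main (E h K y1 : Module.End ℂ V) (x : ℤ → Module.End ℂ V) (q k l p c : ℂ) (v : V)
    (g : ℕ → ℂ) (hp : p = q⁻¹ ^ 2) (hc : c = -k * q⁻¹)
    (hq : q ≠ 0) (hp1 : ∀ n : ℕ, n ≠ 0 → p ^ n ≠ 1) (hk : k ≠ 0)
    (hEF : E * x 1 = x 1 * E + K * h) (hKh : K * h = h * K)
    (hKF : K * x 1 = p • (x 1 * K)) (hKE : K * E = (q ^ 2) • (E * K))
    (hhF : ∀ n, h * x n = x n * h - (q + q⁻¹) • x (n + 1)) (hhE : h * E = E * h + (q + q⁻¹) • y1)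
    (hx : x 2 * x 1 = p • (x 1 * x 2)) (hy : y1 * E = (q ^ 2) • (E * y1))
    (hEv : E v = 0) (hKv : K v = k • v) (hhv : h v = l • v)
    (hEx : ∀ n : ℕ, E (x (n + 1) v) = ((q - q⁻¹)⁻¹ * g (n + 1)) • v) (n : ℕ) :
    (E ^ n) ((x 1 ^ n) v) = (gf p n ^ 2 * c ^ n * useq g k p n) • v ∧
    (E ^ n) ((x 1 ^ (n + 1)) v) = (gf p (n + 1) * gf p n * c ^ n) •
      ∑ j ∈ Finset.range (n + 1), useq g k p (n - j) • x (j + 1) v := by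
  have hfac : (q - q⁻¹) * q⁻¹ = 1 - p := by
    rw [hp]; field_simp
  have hpq : p * q = q⁻¹ := by
    rw [hp]; field_simp
  have hqq : q - q⁻¹ ≠ 0 := by
    intro h
    rw [h, zero_mul] at hfac
    exact hp1 1 (by omega) (by linear_combination hfac)
  have h1p : (1 + p) ≠ 0 := by
    intro h
    exact hp1 2 (by omega) (by linear_combination (p - 1) * h)
  induction n with
  | zero => simp [gf, gs, useq]
  | succ n ih =>
    obtain ⟨_, ih2⟩ := ih
    have step1 : (E ^ (n + 1)) ((x 1 ^ (n + 1)) v) =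
        (gf p (n + 1) ^ 2 * c ^ (n + 1) * useq g k p (n + 1)) • v := by
      rw [pow_succ' E, Module.End.mul_apply, ih2, map_smul, map_sum]
      simp only [map_smul, hEx, smul_smul]
      rw [← Finset.sum_smul, smul_smul]
      congr 1
      have hr := useq_rec g k p hk hp1 n
      have hs := gs_mul p (n + 1)
      have e1 : ∑ i ∈ Finset.range (n + 1), useq g k p (n - i) * ((q - q⁻¹)⁻¹ * g (i + 1)) =
          (q - q⁻¹)⁻¹ * ∑ j ∈ Finset.range (n + 1), g (j + 1) * useq g k p (n - j) := by
        rw [Finset.mul_sum]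
        exact Finset.sum_congr rfl fun i _ => by ring
      rw [e1, ← hr]
      have e2 : k * (p ^ (n + 1) - 1) = (q - q⁻¹) * (c * gs p (n + 1)) := by
        rw [hc]
        linear_combination k * gs p (n + 1) * hfac + k * hs
      rw [e2, mul_assoc (q - q⁻¹), inv_mul_cancel_left₀ hqq]
      rw [show gf p (n + 1) = gf p n * gs p (n + 1) from rfl]
      ring
    refine ⟨step1, ?_⟩
    have st := garland_step E (x 1) h K (x 2) y1 q k l v hq hEF hKh (hp ▸ hKF) hKE
      (hhF 1) hhE (hp ▸ hx) hy hEv hKv hhv n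
    rw [← hp, step1, ih2] at st
    have hhx : ∀ m, h (x m v) = l • x m v - (q + q⁻¹) • x (m + 1) v := by
      intro m
      have := congrArg (fun f : Module.End ℂ V => f v) (hhF m)
      simpa [hhv] using this
    have hT : h ((gf p (n + 1) * gf p n * c ^ n) •
        ∑ j ∈ Finset.range (n + 1), useq g k p (n - j) • x (j + 1) v) -
        l • ((gf p (n + 1) * gf p n * c ^ n) •
        ∑ j ∈ Finset.range (n + 1), useq g k p (n - j) • x (j + 1) v) =
        (-(q + q⁻¹) * (gf p (n + 1) * gf p n * c ^ n)) •
        ∑ j ∈ Finset.range (n + 1), useq g k p (n - j) • x (j + 1 + 1) v := by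
      rw [map_smul, map_sum]
      simp only [map_smul, hhx]
      rw [smul_comm l, ← smul_sub, Finset.smul_sum, ← Finset.sum_sub_distrib, Finset.smul_sum,
        Finset.smul_sum]
      apply Finset.sum_congr rfl
      intro j _
      module
    rw [hT] at st
    apply smul_right_injective V h1p
    show (1 + p) • _ = (1 + p) • _
    rw [show n + 1 + 1 = n + 2 from rfl, st, Finset.sum_range_succ' _ (n + 1)]
    simp only [map_smul, Nat.add_sub_add_right, Nat.cast_add, Nat.cast_one, Nat.cast_zero, zero_add,
      Nat.sub_zero]
    generalize ∑ j ∈ Finset.range (n + 1), useq g k p (n - j) • x (j + 1 + 1) v = W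
    rw [show gf p (n + 2) = gf p (n + 1) * gs p (n + 2) from rfl,
      show gf p (n + 1) = gf p n * gs p (n + 1) from rfl]
    have hB : k * p * (q + q⁻¹) = - c * (1 + p) := by
      rw [hc]
      linear_combination k * hpq
    simp only [smul_add, smul_smul]
    rw [add_comm]
    congr 1
    · congr 1
      rw [pow_succ]
      linear_combination (-(gs p (n + 2) * gs p (n + 1) * gf p n * gs p (n + 1) * gf p n * c ^ n)) * hB
    · congr 1
      ring

theorem shift_lemma [FiniteDimensional ℂ V] (T : Module.End ℂ V) (x : ℤ → V)
    (hT : ∀ n, T (x n) = x (n + 1)) :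
    ∃ r : Polynomial ℂ, r.Monic ∧ r.coeff 0 ≠ 0 ∧
      ∀ n : ℤ, ∑ s ∈ Finset.range (r.natDegree + 1), r.coeff s • x (n + s) = 0 := by
  have hmon : (minpoly ℂ T).Monic := minpoly.monic (Algebra.IsIntegral.isIntegral T)
  obtain ⟨r, hr, hr2⟩ := Polynomial.exists_eq_pow_rootMultiplicity_mul_and_not_dvd
    (minpoly ℂ T) hmon.ne_zero 0
  simp only [map_zero, sub_zero] at hr hr2
  have hpow : ∀ (s : ℕ) n, (T ^ s) (x n) = x (n + s) := by
    intro s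
    induction s with
    | zero => simp
    | succ s ih =>
      intro n
      rw [pow_succ', Module.End.mul_apply, ih, hT]
      congr 1
      push_cast
      ring
  have haev : ∀ (p : Polynomial ℂ) n, (Polynomial.aeval T p) (x n) =
      ∑ s ∈ Finset.range (p.natDegree + 1), p.coeff s • x (n + s) := by
    intro p n
    rw [Polynomial.aeval_eq_sum_range]
    simp [LinearMap.sum_apply, hpow]
  refine ⟨r, ?_, ?_, ?_⟩
  · rw [hr] at hmon
    exact Polynomial.Monic.of_mul_monic_left (Polynomial.monic_X_pow _) hmon
  · intro h
    exact hr2 (Polynomial.X_dvd_iff.mpr h)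
  · intro n
    have h0 := minpoly.aeval ℂ T
    rw [hr, map_mul, map_pow, Polynomial.aeval_X] at h0
    set j := Polynomial.rootMultiplicity 0 (minpoly ℂ T)
    rw [← haev]
    have : (T ^ j * (Polynomial.aeval T) r) (x (n - j)) = 0 := by rw [h0]; rfl
    have hc : T ^ j * (Polynomial.aeval T) r = (Polynomial.aeval T) r * T ^ j := by
      rw [← Polynomial.aeval_X_pow (R := ℂ) (x := T), ← map_mul, ← map_mul, mul_comm]
    rw [hc, Module.End.mul_apply, hpow] at this
    simpa using this

theorem nilp_lemma [FiniteDimensional ℂ V] (K : Module.End ℂ V) (w : ℕ → V) (k p : ℂ) (hk : k ≠ 0)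
    (hp0 : p ≠ 0) (hp1 : ∀ n : ℕ, n ≠ 0 → p ^ n ≠ 1)
    (hw : ∀ n, K (w n) = (k * p ^ n) • w n) : ∃ n0 : ℕ, ∀ n ≥ n0, w n = 0 := by
  have hfin : {μ | K.HasEigenvalue μ}.Finite := Module.End.finite_hasEigenvalue K
  have hinj : Function.Injective (fun n : ℕ => k * p ^ n) := by
    intro a b hab
    have h := mul_left_cancel₀ hk hab
    by_contra hne
    wlog hlt : a < b generalizing a b
    · exact this hab.symm h.symm (Ne.symm hne) (by omega)
    obtain ⟨c, rfl⟩ := Nat.exists_eq_add_of_lt hlt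
    apply hp1 (c + 1) (by omega)
    rw [show a + c + 1 = a + (c + 1) by ring, pow_add] at h
    exact mul_left_cancel₀ (pow_ne_zero a hp0) (by rw [← h, mul_one])
  have hf2 : ((fun n : ℕ => k * p ^ n) ⁻¹' {μ | K.HasEigenvalue μ}).Finite :=
    hfin.preimage hinj.injOn
  obtain ⟨b, hb⟩ := hf2.bddAbove
  refine ⟨b + 1, fun n hn => ?_⟩
  by_contra hne
  have : n ≤ b := hb (by
    show K.HasEigenvalue _
    exact Module.End.hasEigenvalue_of_hasEigenvector
      (x := w n) ⟨Module.End.mem_eigenspace_iff.mpr (hw n), hne⟩)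
  omega

end mod2
end QASProof

namespace QASProof

theorem two_sided (u : Polynomial ℂ) (gp : ℤ → ℂ) (hgp : ∀ n, n < 0 → gp n = 0) (n : ℕ) :
    ∑ s ∈ Finset.range (u.natDegree + 1), u.coeff s * gp ((n : ℤ) - s) =
      ∑ j ∈ Finset.range (n + 1), gp j * u.coeff (n - j) := by
  have h1 : ∑ s ∈ Finset.range (u.natDegree + 1), u.coeff s * gp ((n : ℤ) - s) =
      ∑ s ∈ Finset.range (u.natDegree + 1 + n), u.coeff s * gp ((n : ℤ) - s) := by
    apply Finset.sum_subset
    · intro a; simp only [Finset.mem_range]; omega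
    · intro a _ h
      rw [Polynomial.coeff_eq_zero_of_natDegree_lt, zero_mul]
      simp only [Finset.mem_range] at h; omega
  have h2 : ∑ s ∈ Finset.range (n + 1), u.coeff s * gp ((n : ℤ) - s) =
      ∑ s ∈ Finset.range (u.natDegree + 1 + n), u.coeff s * gp ((n : ℤ) - s) := by
    apply Finset.sum_subset
    · intro a; simp only [Finset.mem_range]; omega
    · intro a _ h
      rw [hgp, mul_zero]
      simp only [Finset.mem_range] at h; omega
  rw [h1, ← h2, ← Finset.sum_range_reflect]
  apply Finset.sum_congr rfl
  intro j hj
  simp only [Finset.mem_range] at hj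
  rw [mul_comm]
  congr 2
  omega

theorem recur_zero (r : Polynomial ℂ) (hr : r.coeff 0 ≠ 0) (w : ℤ → ℂ)
    (hw : ∀ n : ℤ, ∑ s ∈ Finset.range (r.natDegree + 1), r.coeff s * w (n + s) = 0)
    (B : ℤ) (hB : ∀ n, B < n → w n = 0) : ∀ n, w n = 0 := by
  have key : ∀ m : ℕ, ∀ n, B - m < n → w n = 0 := by
    intro m
    induction m with
    | zero => simpa using hB
    | succ m ih =>
      intro n hn
      have h := hw n
      rw [Finset.sum_range_succ', Finset.sum_eq_zero] at h
      · simpa [hr] using h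
      · intro s _
        rw [ih, mul_zero]
        push_cast at hn ⊢
        omega
  intro n
  apply key (B - n + 1).toNat
  omega

section mod3
variable {V : Type*} [AddCommGroup V] [Module ℂ V]

theorem sl2_nilp [FiniteDimensional ℂ V] (E G K Ki : Module.End ℂ V) (q k ε : ℂ) (v : V) (D : ℕ)
    (hq : q ≠ 0) (hq1 : ∀ n : ℕ, n ≠ 0 → q ^ n ≠ 1)
    (hε : ε = 1 ∨ ε = -1) (hk : k = ε * q ^ D)
    (hEG : E * G = G * E + (q - q⁻¹)⁻¹ • (K - Ki)) (hKiK : Ki * K = 1)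
    (hKG : K * G = (q⁻¹ ^ 2) • (G * K))
    (hEv : E v = 0) (hKv : K v = k • v) : (G ^ (1 + D)) v = 0 := by
  have hε0 : ε ≠ 0 := by rcases hε with h | h <;> simp [h]
  have hεi : ε⁻¹ = ε := by rcases hε with h | h <;> norm_num [h]
  have hk0 : k ≠ 0 := by rw [hk]; exact mul_ne_zero hε0 (pow_ne_zero _ hq)
  have hq2 : q ^ 2 ≠ 1 := hq1 2 (by omega)
  have hqq : q - q⁻¹ ≠ 0 := by
    intro h
    apply hq2
    field_simp at h
    linear_combination h
  have hw := pow_weight K G (q⁻¹ ^ 2) k v hKG hKv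
  have hwi : ∀ n, Ki ((G ^ n) v) = (k * (q⁻¹ ^ 2) ^ n)⁻¹ • (G ^ n) v := by
    intro n
    have h1 : Ki (K ((G ^ n) v)) = (G ^ n) v := by
      rw [← Module.End.mul_apply, hKiK]; rfl
    rw [hw n, map_smul] at h1
    rw [← h1, smul_smul, inv_mul_cancel₀, one_smul, h1]
    exact mul_ne_zero hk0 (pow_ne_zero _ (pow_ne_zero _ (inv_ne_zero hq)))
  have hqq1 : ∀ n, k * (q⁻¹ ^ 2) ^ n - (k * (q⁻¹ ^ 2) ^ n)⁻¹ =
      ε * (q ^ D * (q⁻¹ ^ 2) ^ n - (q ^ D * (q⁻¹ ^ 2) ^ n)⁻¹) := by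
    intro n
    rw [hk, mul_assoc ε, mul_inv ε, hεi]; ring
  -- explicit coefficient
  have hE : ∀ n, E ((G ^ (n + 1)) v) = ((q - q⁻¹)⁻¹ ^ 2 * ε * (q ^ (n + 1) - q⁻¹ ^ (n + 1)) *
      (q ^ D * q⁻¹ ^ n - q⁻¹ ^ D * q ^ n)) • (G ^ n) v := by
    intro n
    induction n with
    | zero =>
      have := congrArg (fun f : Module.End ℂ V => f v) hEG
      have hki := hwi 0
      simp only [Module.End.mul_apply, LinearMap.add_apply, LinearMap.smul_apply,
        LinearMap.sub_apply, hEv, map_zero, zero_add, hKv] at this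
      simp only [pow_zero, mul_one, Module.End.one_apply] at hki
      rw [hki] at this
      simp only [zero_add, pow_one, pow_zero, Module.End.one_apply, mul_one]
      rw [this, ← sub_smul, smul_smul]
      congr 1
      have h0 := hqq1 0
      simp only [pow_zero, mul_one] at h0
      rw [h0, pow_two, inv_pow]
      field_simp
    | succ n ih =>
      have := congrArg (fun f : Module.End ℂ V => f ((G ^ (n + 1)) v)) hEG
      simp only [Module.End.mul_apply, LinearMap.add_apply, LinearMap.smul_apply,
        LinearMap.sub_apply, hw, hwi, ih, map_smul] at this
      have e1 : G ((G ^ n) v) = (G ^ (n + 1)) v := by rw [pow_succ' G n]; rfl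
      have e2 : (G ^ (n + 1 + 1)) v = G ((G ^ (n + 1)) v) := by rw [pow_succ' G (n + 1)]; rfl
      rw [e2, this, e1, ← sub_smul, smul_smul, ← add_smul, hqq1]
      congr 1
      have e3 : (q ^ D * (q⁻¹ ^ 2) ^ (n + 1))⁻¹ = q⁻¹ ^ D * q ^ 2 * (q ^ n) ^ 2 := by
        rw [mul_inv, inv_pow, inv_pow, inv_inv, inv_pow]; ring
      have e4 : (q⁻¹ ^ 2) ^ (n + 1) = q⁻¹ ^ 2 * (q⁻¹ ^ n) ^ 2 := by ring
      rw [e3, e4]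
      have hab : q ^ n * q⁻¹ ^ n = 1 := by rw [← mul_pow, mul_inv_cancel₀ hq, one_pow]
      have h1 : q * q⁻¹ = 1 := mul_inv_cancel₀ hq
      simp only [pow_succ q, pow_succ q⁻¹, pow_zero, one_mul]
      generalize q ^ n = a at *
      generalize q⁻¹ ^ n = b at *
      generalize q ^ D = x at *
      generalize q⁻¹ ^ D = y at *
      have h2 : (q - q⁻¹)⁻¹ * (q - q⁻¹) = 1 := inv_mul_cancel₀ hqq
      generalize (q - q⁻¹)⁻¹ = z at *
      generalize q⁻¹ = c at *
      have goal' : (a * q - b * c) * (x * b - y * a) + (q - c) * (x * (c * c * b ^ 2) - y * (q * q) * a ^ 2)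
        = (a * q * q - b * c * c) * (x * (b * c) - y * (a * q)) := by
        linear_combination (-a*b*q*x - a*b*c*y + a^2*q*y + b^2*c*x) * h1
      linear_combination z ^ 2 * ε * goal' - z * ε * (x * (c * c * b ^ 2) - y * (q * q) * a ^ 2) * h2
  by_contra hne
  have hall : ∀ m, (G ^ (1 + D + m)) v ≠ 0 := by
    intro m
    induction m with
    | zero => exact hne
    | succ m ih =>
      intro h0
      have h := hE (1 + D + m)
      rw [show 1 + D + m + 1 = 1 + D + (m + 1) by ring, h0, map_zero] at h
      rcases smul_eq_zero.mp h.symm with h | h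
      · have hz : ∀ a : ℕ, q ^ (a + 1) - q⁻¹ ^ (a + 1) ≠ 0 := by
          intro a ha
          apply hq1 (2 * (a + 1)) (by omega)
          rw [inv_pow, sub_eq_zero] at ha
          rw [two_mul, pow_add]
          nth_rewrite 1 [ha]
          exact inv_mul_cancel₀ (pow_ne_zero _ hq)
        have hf : q ^ D * q⁻¹ ^ (1 + D + m) - q⁻¹ ^ D * q ^ (1 + D + m) =
            - (q ^ (m + 1) - q⁻¹ ^ (m + 1)) := by
          have hD : q ^ D * q⁻¹ ^ D = 1 := by rw [← mul_pow, mul_inv_cancel₀ hq, one_pow]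
          rw [show 1 + D + m = D + (m + 1) by ring, pow_add, pow_add]
          linear_combination (q⁻¹ ^ (m + 1) - q ^ (m + 1)) * hD
        rw [hf] at h
        have h5 := hz (D + m + 1)
        rw [show D + m + 1 + 1 = 1 + D + (m + 1) by ring] at h5
        simp only [mul_eq_zero, neg_eq_zero, hz m, h5, hε0, pow_eq_zero_iff, inv_eq_zero, hqq,
          or_self, ne_eq, OfNat.ofNat_ne_zero, not_false_eq_true] at h
      · exact ih h
  obtain ⟨n0, hn0⟩ := nilp_lemma K (fun n => (G ^ n) v) k (q⁻¹ ^ 2) hk0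
    (pow_ne_zero _ (inv_ne_zero hq)) (by
      intro n hn h
      apply hq1 (2 * n) (by omega)
      rw [← pow_mul, inv_pow] at h
      exact inv_eq_one.mp h) hw
  exact hall n0 (hn0 _ (by omega))

theorem drinfeld [FiniteDimensional ℂ V] (E h K Ki y1 : Module.End ℂ V) (x : ℤ → Module.End ℂ V)
    (q k l : ℂ) (v : V) (gp gm : ℤ → ℂ) (hv : v ≠ 0)
    (hq : q ≠ 0) (hq1 : ∀ n : ℕ, n ≠ 0 → q ^ n ≠ 1) (hk : k ≠ 0)
    (hEF : E * x 1 = x 1 * E + K * h) (hKh : K * h = h * K)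
    (hKF : ∀ n, K * x n = (q⁻¹ ^ 2) • (x n * K)) (hKE : K * E = (q ^ 2) • (E * K))
    (hhF : ∀ n, h * x n = x n * h - (q + q⁻¹) • x (n + 1)) (hhE : h * E = E * h + (q + q⁻¹) • y1)
    (hx : x 2 * x 1 = (q⁻¹ ^ 2) • (x 1 * x 2)) (hy : y1 * E = (q ^ 2) • (E * y1))
    (hE0 : E * x 0 = x 0 * E + (q - q⁻¹)⁻¹ • (K - Ki)) (hKiK : Ki * K = 1)
    (hEv : E v = 0) (hKv : K v = k • v) (hhv : h v = l • v)
    (hgp : ∀ n, n < 0 → gp n = 0) (hgm : ∀ n, 0 < n → gm n = 0)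
    (hgp0 : gp 0 = k) (hgm0 : gm 0 = k⁻¹)
    (hEx : ∀ n : ℤ, E (x n v) = ((q - q⁻¹)⁻¹ * (gp n - gm n)) • v) :
    ∃ (u : Polynomial ℂ) (ε : ℂ), (ε = 1 ∨ ε = -1) ∧ u.coeff 0 = 1 ∧ k = ε * q ^ u.natDegree ∧
      (∀ n : ℕ, ∑ j ∈ Finset.range (n + 1), gp j * u.coeff (n - j) =
        k * (q⁻¹ ^ 2) ^ n * u.coeff n) ∧
      (∀ n : ℤ, ∑ s ∈ Finset.range (u.natDegree + 1), u.coeff s * gm (n - s) =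
        ∑ s ∈ Finset.range (u.natDegree + 1), u.coeff s * gp (n - s)) ∧
      (x 0 ^ (1 + u.natDegree)) v = 0 := by
  obtain ⟨p, hp⟩ : ∃ p, p = q⁻¹ ^ 2 := ⟨_, rfl⟩
  have hp1 : ∀ n : ℕ, n ≠ 0 → p ^ n ≠ 1 := by
    intro n hn h
    apply hq1 (2 * n) (by omega)
    rw [hp, ← pow_mul, inv_pow] at h
    exact inv_eq_one.mp h
  have hp0 : p ≠ 0 := by rw [hp]; exact pow_ne_zero _ (inv_ne_zero hq)
  have hq2 : q ^ 2 ≠ 1 := hq1 2 (by omega)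
  have hqq : q - q⁻¹ ≠ 0 := by
    intro h
    apply hq2
    field_simp at h
    linear_combination h
  have hq2' : q + q⁻¹ ≠ 0 := by
    intro h
    apply hq1 4 (by omega)
    field_simp at h
    linear_combination (q ^ 2 - 1) * h
  obtain ⟨n0, hn0⟩ := nilp_lemma K (fun n => (x 1 ^ n) v) k p hk hp0 hp1
    (pow_weight K (x 1) p k v (hp ▸ hKF 1) hKv)
  have hc0 : -k * q⁻¹ ≠ 0 := mul_ne_zero (neg_ne_zero.mpr hk) (inv_ne_zero hq)
  have huz : ∀ n ≥ n0, useq (fun n => gp n) k p n = 0 := by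
    intro n hn
    have h1 := (garland_main E h K y1 x q k l p (-k * q⁻¹) v (fun n => gp n) hp rfl hq hp1 hk hEF hKh
      (hp ▸ hKF 1) hKE hhF hhE (hp ▸ hx) hy hEv hKv hhv (by
        intro n
        rw [hEx, hgm _ (by omega), sub_zero]
        push_cast; rfl) n).1
    rw [hn0 n hn, map_zero] at h1
    have h2 := (smul_eq_zero.mp h1.symm).resolve_right hv
    have h3 := gf_ne p hp1 n
    simpa [h3, hc0, hk, hq] using h2
  set us := useq (fun n => gp n) k p with hus
  obtain ⟨u, hu⟩ : ∃ u : Polynomial ℂ, ∀ n, u.coeff n = us n := by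
    refine ⟨∑ i ∈ Finset.range n0, Polynomial.monomial i (us i), fun n => ?_⟩
    rw [Polynomial.finsetSum_coeff]
    simp only [Polynomial.coeff_monomial, Finset.sum_ite_eq', Finset.mem_range]
    split_ifs with h
    · rfl
    · exact (huz n (by omega)).symm
  have hu0 : u.coeff 0 = 1 := by rw [hu, hus, useq]
  have hune : u ≠ 0 := by rintro rfl; simp at hu0
  have hconv : ∀ n : ℕ, ∑ j ∈ Finset.range (n + 1), gp j * u.coeff (n - j) =
        k * p ^ n * u.coeff n := by
    intro n
    cases n with
    | zero => simp [hgp0]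
    | succ n =>
      rw [Finset.sum_range_succ']
      have := useq_rec (fun n => gp n) k p hk hp1 n
      simp only [hu, Nat.add_sub_add_right, Nat.cast_zero, hgp0, Nat.sub_zero]
      rw [← this]
      ring
  have hhx : ∀ m, h (x m v) = l • x m v - (q + q⁻¹) • x (m + 1) v := by
    intro m
    have := congrArg (fun f : Module.End ℂ V => f v) (hhF m)
    simpa [hhv] using this
  obtain ⟨r, _, hr0, hr⟩ := shift_lemma (-(q + q⁻¹)⁻¹ • (h - l • (1 : Module.End ℂ V)))
    (fun n => x n v) (by
      intro n
      simp only [LinearMap.smul_apply, LinearMap.sub_apply, hhx, Module.End.one_apply]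
      rw [sub_sub_cancel_left, smul_neg, neg_smul, neg_neg, inv_smul_smul₀ hq2'])
  have hrf : ∀ n : ℤ, ∑ s ∈ Finset.range (r.natDegree + 1),
      r.coeff s * (gp (n + s) - gm (n + s)) = 0 := by
    intro n
    have h1 := congrArg E (hr n)
    simp only [map_sum, map_smul, hEx, smul_smul, map_zero] at h1
    rw [← Finset.sum_smul] at h1
    have h2 := (smul_eq_zero.mp h1).resolve_right hv
    have h3 : ∑ s ∈ Finset.range (r.natDegree + 1),
      r.coeff s * ((q - q⁻¹)⁻¹ * (gp (n + s) - gm (n + s))) = (q - q⁻¹)⁻¹ *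
        ∑ s ∈ Finset.range (r.natDegree + 1), r.coeff s * (gp (n + s) - gm (n + s)) := by
      rw [Finset.mul_sum]
      exact Finset.sum_congr rfl fun i _ => by ring
    rw [h3] at h2
    exact (mul_eq_zero.mp h2).resolve_left (inv_ne_zero hqq)
  have hw := recur_zero r hr0 (fun n => ∑ s ∈ Finset.range (u.natDegree + 1),
      u.coeff s * (gp (n - s) - gm (n - s))) (by
      intro n
      simp only [Finset.mul_sum]
      rw [Finset.sum_comm]
      apply Finset.sum_eq_zero
      intro s _
      have h1 := congrArg (fun t => u.coeff s * t) (hrf (n - s))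
      simp only [mul_zero, Finset.mul_sum] at h1
      rw [← h1]
      apply Finset.sum_congr rfl
      intro t _
      rw [show n + (t : ℤ) - s = n - s + t by ring]
      ring) (u.natDegree : ℤ) (by
      intro n hn
      have hn' : n = ((n.toNat : ℕ) : ℤ) := by omega
      simp only [mul_sub, Finset.sum_sub_distrib]
      rw [Finset.sum_eq_zero (f := fun s : ℕ => u.coeff s * gm (n - s)), sub_zero, hn',
        two_sided u gp hgp, hconv, Polynomial.coeff_eq_zero_of_natDegree_lt, mul_zero]
      · omega
      · intro s hs
        simp only [Finset.mem_range] at hs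
        rw [hgm, mul_zero]
        omega)
  have hw2 : ∀ n : ℤ, ∑ s ∈ Finset.range (u.natDegree + 1), u.coeff s * gm (n - s) =
        ∑ s ∈ Finset.range (u.natDegree + 1), u.coeff s * gp (n - s) := by
    intro n
    have := hw n
    simp only [mul_sub, Finset.sum_sub_distrib] at this
    exact (sub_eq_zero.mp this).symm
  have hkk : k⁻¹ = k * p ^ u.natDegree := by
    have h1 := hw2 u.natDegree
    rw [two_sided u gp hgp, hconv, Finset.sum_range_succ, Finset.sum_eq_zero, zero_add, sub_self,
      hgm0, mul_comm] at h1
    · exact mul_right_cancel₀ (by simpa using hune : u.coeff u.natDegree ≠ 0) h1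
    · intro s hs
      simp only [Finset.mem_range] at hs
      rw [hgm, mul_zero]
      omega
  have hε : k / q ^ u.natDegree = 1 ∨ k / q ^ u.natDegree = -1 := by
    apply mul_self_eq_one_iff.mp
    have h1 : k * (k * p ^ u.natDegree) = 1 := by rw [← hkk]; exact mul_inv_cancel₀ hk
    have h2 : p ^ u.natDegree = (q ^ u.natDegree)⁻¹ * (q ^ u.natDegree)⁻¹ := by
      rw [hp, ← pow_mul, mul_comm, pow_mul, inv_pow, pow_two]
    rw [h2] at h1
    rw [div_eq_mul_inv]
    linear_combination h1
  have hkε : k = k / q ^ u.natDegree * q ^ u.natDegree := by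
    rw [div_mul_cancel₀]; exact pow_ne_zero _ hq
  refine ⟨u, k / q ^ u.natDegree, hε, hu0, hkε, hp ▸ hconv, hw2, ?_⟩
  exact sl2_nilp E (x 0) K Ki q k _ v u.natDegree hq hq1 hε hkε hE0 hKiK (hKF 0) hEv hKv

end mod3
end QASProof

namespace QASProof
open QAS

theorem pscale_coeff (a : ℂ) (P : Polynomial ℂ) (n : ℕ) :
    (pscale a P).coeff n = P.coeff n * a ^ n := by
  rw [pscale, Polynomial.comp_C_mul_X_coeff]

theorem pscale_natDegree (a : ℂ) (ha : a ≠ 0) (P : Polynomial ℂ) :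
    (pscale a P).natDegree = P.natDegree := by
  rw [pscale, Polynomial.natDegree_comp, Polynomial.natDegree_C_mul_X _ ha, mul_one]

theorem pscale_inv (a : ℂ) (ha : a ≠ 0) (P : Polynomial ℂ) :
    pscale a (pscale a⁻¹ P) = P := by
  ext n
  rw [pscale_coeff, pscale_coeff, mul_assoc, ← mul_pow, inv_mul_cancel₀ ha, one_pow, mul_one]

theorem coeff_toPS (p : Polynomial ℂ) (n : ℕ) : PowerSeries.coeff n (toPS p) = p.coeff n := by
  simp [toPS]

theorem ps_div (A B C : PowerSeries ℂ) (hB : PowerSeries.constantCoeff B ≠ 0)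
    (h : A * B = C) : A = C * B⁻¹ := by
  rw [← h, mul_assoc, PowerSeries.mul_inv_cancel _ hB, mul_one]

theorem gamma_P (q : ℂ) (M i : ℕ) (hq : qpar q M i ≠ 0) (u : Polynomial ℂ) (hu0 : u.coeff 0 = 1)
    (k ε : ℂ) (hk : k = ε * qpar q M i ^ u.natDegree) (gp : ℤ → ℂ) (hgp : ∀ n, n < 0 → gp n = 0)
    (hconv : ∀ n : ℕ, ∑ j ∈ Finset.range (n + 1), gp j * u.coeff (n - j) =
        k * ((qpar q M i)⁻¹ ^ 2) ^ n * u.coeff n) (n : ℤ) :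
    gp n = ε * gammaP q M i (pscale (qpar q M i)⁻¹ u) n := by
  rw [gammaP, pscale_natDegree _ (inv_ne_zero hq), pscale_inv _ hq]
  generalize qpar q M i = a at *
  split_ifs with h
  · have key := ps_div (PowerSeries.mk fun n : ℕ => gp n) (toPS u)
      (PowerSeries.C k * toPS (pscale a⁻¹ (pscale a⁻¹ u))) (by
        rw [← PowerSeries.coeff_zero_eq_constantCoeff_apply, coeff_toPS, hu0]; exact one_ne_zero) (by
        ext n
        rw [PowerSeries.coeff_C_mul, coeff_toPS, pscale_coeff, pscale_coeff, PowerSeries.coeff_mul,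
          Finset.Nat.sum_antidiagonal_eq_sum_range_succ_mk]
        simp only [PowerSeries.coeff_mk, coeff_toPS]
        rw [hconv]
        ring)
    have := congrArg (PowerSeries.coeff n.toNat) key
    rw [PowerSeries.coeff_mk, mul_assoc, PowerSeries.coeff_C_mul, Int.toNat_of_nonneg h] at this
    rw [this, hk, mul_assoc]
  · rw [hgp _ (by omega), mul_zero]

theorem coeff_reflect' (p : Polynomial ℂ) (D b : ℕ) (hp : p.natDegree ≤ D) :
    (p.reflect D).coeff b = if b ≤ D then p.coeff (D - b) else 0 := by
  rw [Polynomial.coeff_reflect]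
  split_ifs with h
  · rw [Polynomial.revAt_le h]
  · rw [Polynomial.revAt_eq_self_of_lt (by omega), Polynomial.coeff_eq_zero_of_natDegree_lt (by omega)]

theorem gamma_M (q : ℂ) (M i : ℕ) (hq : qpar q M i ≠ 0) (u : Polynomial ℂ) (hu0 : u.coeff 0 = 1)
    (k ε : ℂ) (hk : k = ε * qpar q M i ^ u.natDegree) (gp gm : ℤ → ℂ) 
    (hgp : ∀ n, n < 0 → gp n = 0) (hgm : ∀ n, 0 < n → gm n = 0)
    (hconv : ∀ n : ℕ, ∑ j ∈ Finset.range (n + 1), gp j * u.coeff (n - j) =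
        k * ((qpar q M i)⁻¹ ^ 2) ^ n * u.coeff n) 
    (htwo : ∀ n : ℤ, ∑ s ∈ Finset.range (u.natDegree + 1), u.coeff s * gm (n - s) =
        ∑ s ∈ Finset.range (u.natDegree + 1), u.coeff s * gp (n - s)) (n : ℤ) :
    gm n = ε * gammaM q M i (pscale (qpar q M i)⁻¹ u) n := by
  rw [gammaM, pscale_natDegree _ (inv_ne_zero hq), pscale_inv _ hq]
  generalize qpar q M i = a at *
  have hun : u ≠ 0 := by rintro rfl; simp at hu0
  split_ifs with h
  · have key := ps_div (PowerSeries.mk fun n : ℕ => gm (-n)) (toPS (u.reflect u.natDegree))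
      (PowerSeries.C k * toPS ((pscale a⁻¹ (pscale a⁻¹ u)).reflect u.natDegree)) (by
        rw [← PowerSeries.coeff_zero_eq_constantCoeff_apply, coeff_toPS, coeff_reflect' _ _ _ le_rfl]
        simpa using hun) (by
        ext n
        rw [PowerSeries.coeff_C_mul, coeff_toPS, coeff_reflect' _ _ _ (by
            rw [pscale_natDegree _ (inv_ne_zero hq), pscale_natDegree _ (inv_ne_zero hq)]),
          pscale_coeff, pscale_coeff, PowerSeries.coeff_mul, mul_comm,
          Finset.Nat.sum_antidiagonal_eq_sum_range_succ_mk]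
        simp only [PowerSeries.coeff_mk, coeff_toPS, coeff_reflect' _ _ _ le_rfl]
        have h1 := htwo ((u.natDegree : ℤ) - n)
        have hL : ∑ j ∈ Finset.range (n + 1), gm (-(j : ℤ)) *
              (if n - j ≤ u.natDegree then u.coeff (u.natDegree - (n - j)) else 0) =
            ∑ s ∈ Finset.range (u.natDegree + 1), u.coeff s * gm ((u.natDegree : ℤ) - n - s) := by
          rw [← Finset.sum_range_reflect, ← Finset.sum_range_reflect (n := u.natDegree + 1)]
          have e1 : ∀ j ∈ Finset.range (n + 1), gm (-((n + 1 - 1 - j : ℕ) : ℤ)) *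
              (if n - (n + 1 - 1 - j) ≤ u.natDegree then u.coeff (u.natDegree - (n - (n + 1 - 1 - j)))
                else 0) = if j ≤ u.natDegree then gm ((j : ℤ) - n) * u.coeff (u.natDegree - j)
                else 0 := by
            intro j hj
            simp only [Finset.mem_range] at hj
            rw [show n - (n + 1 - 1 - j) = j by omega,
              show (-((n + 1 - 1 - j : ℕ) : ℤ)) = (j : ℤ) - n by omega]
            split_ifs <;> simp
          rw [Finset.sum_congr rfl e1]
          have e2 : ∀ j ∈ Finset.range (u.natDegree + 1), u.coeff (u.natDegree + 1 - 1 - j) *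
              gm ((u.natDegree : ℤ) - n - ((u.natDegree + 1 - 1 - j : ℕ) : ℤ)) =
              if j ≤ u.natDegree then gm ((j : ℤ) - n) * u.coeff (u.natDegree - j) else 0 := by
            intro j hj
            simp only [Finset.mem_range] at hj
            rw [if_pos (by omega), show u.natDegree + 1 - 1 - j = u.natDegree - j by omega,
              show (u.natDegree : ℤ) - n - ((u.natDegree - j : ℕ) : ℤ) = (j : ℤ) - n by omega,
              mul_comm]
          rw [Finset.sum_congr rfl e2]
          have s1 := Finset.sum_subset (f := fun j : ℕ => 
            if j ≤ u.natDegree then gm ((j : ℤ) - n) * u.coeff (u.natDegree - j) else 0)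
            (s₁ := Finset.range (n + 1)) (s₂ := Finset.range (n + 1 + u.natDegree)) (by
              intro a; simp only [Finset.mem_range]; omega) (by
              intro a _ ha
              simp only [Finset.mem_range] at ha
              rw [hgm _ (by omega)]; simp)
          have s2 := Finset.sum_subset (f := fun j : ℕ => 
            if j ≤ u.natDegree then gm ((j : ℤ) - n) * u.coeff (u.natDegree - j) else 0)
            (s₁ := Finset.range (u.natDegree + 1)) (s₂ := Finset.range (n + 1 + u.natDegree)) (by
              intro a; simp only [Finset.mem_range]; omega) (by
              intro a _ ha
              simp only [Finset.mem_range] at ha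
              rw [if_neg (by omega)])
          rw [s1, s2]
        rw [hL, h1]
        split_ifs with hn
        · rw [show (u.natDegree : ℤ) - n = ((u.natDegree - n : ℕ) : ℤ) by omega,
            two_sided u gp hgp, hconv]
          ring
        · rw [zero_mul]
          apply Finset.sum_eq_zero
          intro s _
          rw [hgp _ (by omega), mul_zero])
    have := congrArg (PowerSeries.coeff (-n).toNat) key
    rw [PowerSeries.coeff_mk, mul_assoc, PowerSeries.coeff_C_mul, Int.toNat_of_nonneg (by omega),
      neg_neg] at this
    rw [this, hk, mul_assoc]
  · rw [hgm _ (by omega), mul_zero]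

end QASProof

namespace QASProof
open QAS
section mod5
variable {V : Type*} [AddCommGroup V] [Module ℂ V]

theorem common_eig [FiniteDimensional ℂ V] {ι : Type*} (T : ι → Module.End ℂ V)
    (hc : ∀ i j, T i * T j = T j * T i) :
    ∀ (n : ℕ) (W : Submodule ℂ V), Module.finrank ℂ W = n → W ≠ ⊥ →
      (∀ i, ∀ w ∈ W, T i w ∈ W) → ∃ v ∈ W, v ≠ 0 ∧ ∀ i, ∃ μ : ℂ, T i v = μ • v := by
  intro n
  induction n using Nat.strong_induction_on with
  | _ n ih =>
  intro W hn hW hT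
  have hev : ∀ i, ∃ μ : ℂ, ∃ w ∈ W, w ≠ 0 ∧ T i w = μ • w := by
    intro i
    have : Nontrivial W := Submodule.nontrivial_iff_ne_bot.mpr hW
    obtain ⟨μ, hμ⟩ := Module.End.exists_eigenvalue ((T i).restrict (hT i))
    obtain ⟨w, hw⟩ := hμ.exists_hasEigenvector
    refine ⟨μ, w, w.2, ?_, ?_⟩
    · simpa using hw.2
    · have := congrArg Subtype.val hw.apply_eq_smul
      simpa using this
  choose μ w hwW hw0 hw using hev
  by_cases hall : ∀ i, W ≤ Module.End.eigenspace (T i) (μ i)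
  · obtain ⟨v, hv, hv0⟩ := W.exists_mem_ne_zero_of_ne_bot hW
    exact ⟨v, hv, hv0, fun i => ⟨μ i, Module.End.mem_eigenspace_iff.mp (hall i hv)⟩⟩
  · push Not at hall
    obtain ⟨i, hi⟩ := hall
    have hlt : W ⊓ Module.End.eigenspace (T i) (μ i) < W := by
      refine lt_of_le_of_ne inf_le_left ?_
      intro h
      exact hi (inf_eq_left.mp h)
    obtain ⟨v, hv, h⟩ := ih _ (hn ▸ Submodule.finrank_lt_finrank_of_lt hlt) _ rfl (by
      intro h
      have hm : w i ∈ W ⊓ Module.End.eigenspace (T i) (μ i) :=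
        ⟨hwW i, Module.End.mem_eigenspace_iff.mpr (hw i)⟩
      rw [h] at hm
      exact hw0 i (by simpa using hm)) (by
      rintro j x ⟨hx1, hx2⟩
      refine ⟨hT j x hx1, ?_⟩
      have hx2 := Module.End.mem_eigenspace_iff.mp hx2
      refine Module.End.mem_eigenspace_iff.mpr ?_
      rw [← Module.End.mul_apply, hc i j, Module.End.mul_apply, hx2, map_smul])
    exact ⟨v, hv.1, h⟩

theorem hw_abs [FiniteDimensional ℂ V] [Nontrivial V] {ι α : Type*} (T : ι → Module.End ℂ V)
    (X : α → Module.End ℂ V) (D B : Module.End ℂ V) (q : ℂ) (hq : q ≠ 0)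
    (hq1 : ∀ n : ℕ, n ≠ 0 → q ^ n ≠ 1)
    (hc : ∀ i j, T i * T j = T j * T i) (hBD : B * D = 1) (hDX : ∀ a, D * X a = q • (X a * D))
    (hTD : ∀ i, T i * D = D * T i) :
    ∃ v : V, v ≠ 0 ∧ (∀ a, X a v = 0) ∧ ∀ i, ∃ μ : ℂ, T i v = μ • v := by
  obtain ⟨μ0, hμ0⟩ := Module.End.exists_eigenvalue D
  have hμ00 : μ0 ≠ 0 := by
    obtain ⟨w, hw⟩ := hμ0.exists_hasEigenvector
    rintro rfl
    have h1 : B (D w) = w := by rw [← Module.End.mul_apply, hBD]; rfl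
    rw [hw.apply_eq_smul, zero_smul, map_zero] at h1
    exact hw.2 h1.symm
  have hex : ∃ n : ℕ, D.HasEigenvalue (μ0 * q ^ n) ∧ ¬ D.HasEigenvalue (μ0 * q ^ (n + 1)) := by
    by_contra hcon
    push Not at hcon
    have hall : ∀ n : ℕ, D.HasEigenvalue (μ0 * q ^ n) := by
      intro n
      induction n with
      | zero => simpa using hμ0
      | succ n ih => exact hcon n ih
    choose x hx using fun n => (hall n).exists_hasEigenvector
    obtain ⟨n0, hn0⟩ := nilp_lemma D x μ0 q hμ00 hq hq1 (fun n => (hx n).apply_eq_smul)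
    exact (hx n0).2 (hn0 n0 le_rfl)
  obtain ⟨n, h1, h2⟩ := hex
  obtain ⟨v, hv, hv0, hvT⟩ := common_eig T hc _ (D.eigenspace (μ0 * q ^ n)) rfl h1 (by
    intro i w hw
    have hw := Module.End.mem_eigenspace_iff.mp hw
    refine Module.End.mem_eigenspace_iff.mpr ?_
    rw [← Module.End.mul_apply, ← hTD i, Module.End.mul_apply, hw, map_smul])
  refine ⟨v, hv0, fun a => ?_, hvT⟩
  by_contra hne
  apply h2
  refine Module.End.hasEigenvalue_of_hasEigenvector (x := X a v) ⟨?_, hne⟩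
  refine Module.End.mem_eigenspace_iff.mpr ?_
  rw [← Module.End.mul_apply, hDX, LinearMap.smul_apply, Module.End.mul_apply,
    Module.End.mem_eigenspace_iff.mp hv, map_smul, smul_smul]
  congr 1
  ring

def expSub {ι J : Type*} (T : ι → Module.End ℂ V)
    (X : J → ℤ → Module.End ℂ V) (q : ℂ) (hq : q ≠ 0) : AddSubgroup (J → ℤ) where
  carrier := {d | ∃ A B : Module.End ℂ V, A * B = 1 ∧ B * A = 1 ∧
    (∀ j n, A * X j n = (q ^ d j) • (X j n * A)) ∧ ∀ i, T i * A = A * T i}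
  zero_mem' := ⟨1, 1, by simp, by simp, by simp, by simp⟩
  add_mem' := by
    rintro a b ⟨A, A', h1, h2, h3, h4⟩ ⟨B, B', g1, g2, g3, g4⟩
    refine ⟨A * B, B' * A', ?_, ?_, ?_, ?_⟩
    · rw [mul_assoc, ← mul_assoc B, g1, one_mul, h1]
    · rw [mul_assoc, ← mul_assoc A', h2, one_mul, g2]
    · intro j n
      rw [mul_assoc, g3, mul_smul_comm, ← mul_assoc, h3, smul_mul_assoc, smul_smul, mul_assoc,
        Pi.add_apply, zpow_add₀ hq, mul_comm (q ^ b j)]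
    · intro i
      rw [← mul_assoc, h4, mul_assoc, g4, mul_assoc]
  neg_mem' := by
    rintro a ⟨A, B, h1, h2, h3, h4⟩
    refine ⟨B, A, h2, h1, ?_, ?_⟩
    · intro j n
      have e : B * (A * X j n) * B = B * ((q ^ a j) • (X j n * A)) * B := by rw [h3]
      have e1 : B * (A * X j n) * B = X j n * B := by rw [← mul_assoc, h2, one_mul]
      have e2 : B * ((q ^ a j) • (X j n * A)) * B = (q ^ a j) • (B * X j n) := by
        rw [mul_smul_comm, smul_mul_assoc, mul_assoc, mul_assoc (X j n), h1, mul_one]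
      rw [e1, e2] at e
      rw [e, Pi.neg_apply, zpow_neg, inv_smul_smul₀ (zpow_ne_zero _ hq)]
    · intro i
      have e : B * (T i * A) * B = B * (A * T i) * B := by rw [h4]
      rw [← mul_assoc B A, h2, one_mul, mul_assoc, mul_assoc (T i), h1, mul_one] at e
      exact e.symm

theorem exp_one (M R : ℕ) (hM : 1 ≤ M) (S : AddSubgroup ({i : ℕ // 1 ≤ i ∧ i ≤ R} → ℤ))
    (h0 : (fun j : {i : ℕ // 1 ≤ i ∧ i ≤ R} => if j.1 = 1 then (1 : ℤ) else 0) ∈ S)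
    (hc : ∀ i : {i : ℕ // 1 ≤ i ∧ i ≤ R}, (fun j : {i : ℕ // 1 ≤ i ∧ i ≤ R} => cc M i.1 j.1) ∈ S) :
    (fun _ => 1) ∈ S := by
  have he : ∀ k : ℕ, k ≤ R →
      (fun j : {i : ℕ // 1 ≤ i ∧ i ≤ R} => innerE M (k + 1) j.1 - innerE M (k + 1) (j.1 + 1)) ∈ S := by
    intro k
    induction k with
    | zero =>
      intro _
      convert h0 using 2 with j
      have := j.2.1
      simp only [innerE, lof]
      split_ifs <;> omega
    | succ k ih =>
      intro hk
      convert S.sub_mem (ih (by omega)) (hc ⟨k + 1, by omega, by omega⟩) using 1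
      funext j
      simp only [Pi.sub_apply, cc, form4]
      ring
  have hs := S.sum_mem (t := Finset.range (R + 1)) (fun k hk => S.zsmul_mem (he k (by
    simp only [Finset.mem_range] at hk; omega)) (-(lof M (k + 1)) * ((k : ℤ) + 1)))
  convert hs using 1
  funext j
  have hj := j.2
  have hl : ∀ m, lof M m * lof M m = 1 := by
    intro m; unfold lof; split_ifs <;> rfl
  simp only [Finset.sum_apply, Pi.smul_apply, smul_eq_mul, mul_sub, Finset.sum_sub_distrib, innerE]
  have e1 : ∑ k ∈ Finset.range (R + 1), -lof M (k + 1) * ((k : ℤ) + 1) *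
      (if k + 1 = j.1 then lof M (k + 1) else 0) = - (j.1 : ℤ) := by
    rw [Finset.sum_eq_single (j.1 - 1)]
    · rw [show j.1 - 1 + 1 = j.1 by omega, if_pos rfl]
      rw [show ((j.1 - 1 : ℕ) : ℤ) + 1 = j.1 by omega]
      linear_combination (-(j.1 : ℤ)) * hl j.1
    · intro b _ hb
      rw [if_neg (by omega), mul_zero]
    · intro h; simp only [Finset.mem_range] at h; omega
  have e2 : ∑ k ∈ Finset.range (R + 1), -lof M (k + 1) * ((k : ℤ) + 1) *
      (if k + 1 = j.1 + 1 then lof M (k + 1) else 0) = - (j.1 + 1 : ℤ) := by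
    rw [Finset.sum_eq_single j.1]
    · rw [if_pos rfl]
      linear_combination (-(j.1 + 1 : ℤ)) * hl (j.1 + 1)
    · intro b _ hb
      rw [if_neg (by omega), mul_zero]
    · intro h; simp only [Finset.mem_range] at h; omega
  rw [e1, e2]; ring

theorem expC_eig {A : Type} [Ring A] [Algebra ℂ A] (ρ : A →ₐ[ℂ] Module.End ℂ V) (v : V)
    (t : ℂ) (a : ℕ → A) (ha : ∀ s, ∃ μ : ℂ, ρ (a (s + 1)) v = μ • v) (n : ℕ) :
    ∃ μ : ℂ, ρ (expC t a n) v = μ • v := by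
  induction n using Nat.strong_induction_on with
  | _ n ih =>
  cases n with
  | zero => exact ⟨1, by simp [expC]⟩
  | succ n =>
    choose μ hμ using ha
    have : ∀ s : ℕ, ∃ ν : ℂ, ρ (expC t a (n - s)) v = ν • v := fun s => ih _ (by omega)
    choose ν hν using this
    refine ⟨((n : ℂ) + 1)⁻¹ * (t * ∑ s ∈ Finset.range (n + 1), ((s : ℂ) + 1) * (ν s * μ s)), ?_⟩
    rw [expC]
    simp only [map_smul, map_sum, map_mul, LinearMap.smul_apply, LinearMap.sum_apply,
      Module.End.mul_apply, hν, hμ, smul_smul, ← Finset.sum_smul]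
    rw [mul_assoc]

end mod5
end QASProof

namespace QASProof
open QAS
section mod6
variable {V : Type*} [AddCommGroup V] [Module ℂ V]

/-- the commuting Cartan generators. -/
def isCartan {M N : ℕ} : Gen M N true → Prop
  | Gen.K _ => True
  | Gen.Ki _ => True
  | Gen.H _ _ => True
  | Gen.K0 _ => True
  | _ => False

theorem cartan_comm (q : ℂ) (M N : ℕ) (π : FA M N true →ₐ[ℂ] Module.End ℂ V)
    (hrel : ∀ a b, rel q M N true 3 a b → π a = π b) (g g' : Gen M N true)
    (hg : isCartan g) (hg' : isCartan g') : π (gi g) * π (gi g') = π (gi g') * π (gi g) := by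
  rw [← map_mul, ← map_mul]
  cases g <;> cases g' <;> simp only [isCartan] at hg hg' <;>
  first
    | rfl
    | exact hrel _ _ (rel.KK _ _)
    | exact hrel _ _ (rel.KKi2 _ _)
    | exact (hrel _ _ (rel.KKi2 _ _)).symm
    | exact hrel _ _ (rel.KiKi _ _)
    | exact hrel _ _ (rel.KH _ _ _)
    | exact (hrel _ _ (rel.KH _ _ _)).symm
    | exact hrel _ _ (rel.KiH _ _ _)
    | exact (hrel _ _ (rel.KiH _ _ _)).symm
    | exact hrel _ _ (rel.HH _ _ _ _)
    | exact hrel _ _ (rel.K0K _ _)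
    | exact (hrel _ _ (rel.K0K _ _)).symm
    | exact hrel _ _ (rel.K0Ki _ _)
    | exact (hrel _ _ (rel.K0Ki _ _)).symm
    | exact hrel _ _ (rel.K0H _ _ _)
    | exact (hrel _ _ (rel.K0H _ _ _)).symm

theorem hwvec [FiniteDimensional ℂ V] [Nontrivial V] (q : ℂ) (hq0 : q ≠ 0)
    (hq1 : ∀ k : ℕ, k ≠ 0 → q ^ k ≠ 1) (M N : ℕ) (hM : 1 ≤ M)
    (π : FA M N true →ₐ[ℂ] Module.End ℂ V)
    (hrel : ∀ a b, rel q M N true 3 a b → π a = π b) :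
    ∃ v : V, v ≠ 0 ∧ (∀ i n, π (gi (Gen.Xp i n)) v = 0) ∧
      ∀ g, isCartan g → ∃ μ : ℂ, π (gi g) v = μ • v := by
  let T : {g : Gen M N true // isCartan g} → Module.End ℂ V := fun g => π (gi g.1)
  let X : Idx M N → ℤ → Module.End ℂ V := fun j n => π (gi (Gen.Xp j n))
  have h1 := exp_one M (M + N - 1) hM (expSub T X q hq0) (by
    refine ⟨π (gi (Gen.K0 rfl)), π (gi (Gen.K0i rfl)), ?_, ?_, ?_, ?_⟩
    · rw [← map_mul, hrel _ _ (rel.K0K0i rfl), map_one]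
    · rw [← map_mul, hrel _ _ (rel.K0iK0 rfl), map_one]
    · intro j n
      rw [← map_mul, hrel _ _ (rel.K0Xp rfl j n), map_smul, map_mul]
    · intro i
      exact cartan_comm q M N π hrel _ _ i.2 trivial) (by
    intro k
    refine ⟨π (gi (Gen.K k)), π (gi (Gen.Ki k)), ?_, ?_, ?_, ?_⟩
    · rw [← map_mul, hrel _ _ (rel.KKi k), map_one]
    · rw [← map_mul, hrel _ _ (rel.KiK k), map_one]
    · intro j n
      rw [← map_mul, hrel _ _ (rel.KXp k j n), map_smul, map_mul]
    · intro i
      exact cartan_comm q M N π hrel _ _ i.2 trivial)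
  obtain ⟨D, B, -, hBD, hDX, hTD⟩ := h1
  obtain ⟨v, hv, hX, hT⟩ := hw_abs T (fun a : Idx M N × ℤ => X a.1 a.2) D B q hq0 hq1
    (fun i j => cartan_comm q M N π hrel _ _ i.2 j.2) hBD (by
      intro a
      simpa using hDX a.1 a.2) hTD
  exact ⟨v, hv, fun i n => hX (i, n), fun g hg => hT ⟨g, hg⟩⟩

theorem phi_scalar (q : ℂ) (M N : ℕ) (π : FA M N true →ₐ[ℂ] Module.End ℂ V)
    (hrel : ∀ a b, rel q M N true 3 a b → π a = π b) (v : V) (hv : v ≠ 0)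
    (hc : ∀ g, isCartan g → ∃ μ : ℂ, π (gi g) v = μ • v) (i : Idx M N) :
    ∃ (gp gm : ℤ → ℂ) (k : ℂ), k ≠ 0 ∧ π (gi (Gen.K i)) v = k • v ∧
      (∀ n, π (phiPF q M N true i.1 n) v = gp n • v) ∧
      (∀ n, π (phiMF q M N true i.1 n) v = gm n • v) ∧
      (∀ n, n < 0 → gp n = 0) ∧ (∀ n, 0 < n → gm n = 0) ∧ gp 0 = k ∧ gm 0 = k⁻¹ := by
  have hKF : KF M N true i.1 = gi (Gen.K i) := by rw [KF, dif_pos i.2]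
  have hKiF : KiF M N true i.1 = gi (Gen.Ki i) := by rw [KiF, dif_pos i.2]
  have hHF : ∀ s, ∃ μ : ℂ, π (HF M N true i.1 s) v = μ • v := by
    intro s
    rw [HF]
    split_ifs with h
    · exact hc _ trivial
    · exact ⟨0, by simp⟩
  obtain ⟨k, hk⟩ := hc (Gen.K i) trivial
  obtain ⟨k', hk'⟩ := hc (Gen.Ki i) trivial
  have hkk : k * k' = 1 := by
    have h1 := congrArg (fun f : Module.End ℂ V => f v) (hrel _ _ (rel.KKi i))
    simp only [map_mul, map_one, Module.End.mul_apply, hk', map_smul, hk, smul_smul,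
      Module.End.one_apply] at h1
    have h2 : (k' * k - 1) • v = 0 := by rw [sub_smul, h1, one_smul, sub_self]
    linear_combination (smul_eq_zero.mp h2).resolve_right hv
  have hk0 : k ≠ 0 := left_ne_zero_of_mul_eq_one hkk
  have hki : k' = k⁻¹ := (inv_eq_of_mul_eq_one_right hkk).symm
  have hp : ∀ n : ℤ, ∃ g : ℂ, π (phiPF q M N true i.1 n) v = g • v := by
    intro n
    rw [phiPF]
    split_ifs with h
    · obtain ⟨μ, hμ⟩ := expC_eig π v (qpar q M i.1 - (qpar q M i.1)⁻¹)
        (fun s => HF M N true i.1 (s : ℤ)) (fun s => hHF _) n.toNat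
      exact ⟨μ * k, by rw [hKF, map_mul, Module.End.mul_apply, hμ, map_smul, hk, smul_smul]⟩
    · exact ⟨0, by simp⟩
  have hm : ∀ n : ℤ, ∃ g : ℂ, π (phiMF q M N true i.1 n) v = g • v := by
    intro n
    rw [phiMF]
    split_ifs with h
    · obtain ⟨μ, hμ⟩ := expC_eig π v (-(qpar q M i.1 - (qpar q M i.1)⁻¹))
        (fun s => HF M N true i.1 (-(s : ℤ))) (fun s => hHF _) (-n).toNat
      exact ⟨μ * k', by rw [hKiF, map_mul, Module.End.mul_apply, hμ, map_smul, hk', smul_smul]⟩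
    · exact ⟨0, by simp⟩
  choose gp hgp using hp
  choose gm hgm using hm
  have inj : ∀ a b : ℂ, a • v = b • v → a = b := by
    intro a b h
    exact smul_left_injective ℂ hv h
  refine ⟨gp, gm, k, hk0, hk, hgp, hgm, ?_, ?_, ?_, ?_⟩
  · intro n hn
    apply inj
    rw [← hgp, phiPF, if_neg (by omega)]; simp
  · intro n hn
    apply inj
    rw [← hgm, phiMF, if_neg (by omega)]; simp
  · apply inj
    rw [← hgp, phiPF, if_pos le_rfl, hKF]; simp [expC, hk]
  · apply inj
    rw [← hgm, phiMF, if_pos le_rfl, hKiF]; simp [expC, hk', hki]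

theorem qpar_ne (q : ℂ) (hq0 : q ≠ 0) (M i : ℕ) : qpar q M i ≠ 0 := zpow_ne_zero _ hq0

theorem qpar_pow_ne (q : ℂ) (hq1 : ∀ k : ℕ, k ≠ 0 → q ^ k ≠ 1) (M i : ℕ) :
    ∀ k : ℕ, k ≠ 0 → qpar q M i ^ k ≠ 1 := by
  intro k hk h
  apply hq1 k hk
  unfold qpar lof at h
  split_ifs at h
  · simpa using h
  · simpa using h

theorem sub_inv_ne (q : ℂ) (hq0 : q ≠ 0) (hq1 : ∀ k : ℕ, k ≠ 0 → q ^ k ≠ 1) : q - q⁻¹ ≠ 0 := by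
  intro h
  apply hq1 2 (by omega)
  field_simp at h
  linear_combination h

theorem cc_self (M i : ℕ) (hi : i ≠ M) : cc M i i = 2 * lof M i := by
  unfold cc form4 innerE lof
  split_ifs <;> omega

theorem lof_sq (M i : ℕ) : lof M i * lof M i = 1 := by
  unfold lof; split_ifs <;> rfl

theorem qint_two (v : ℂ) (h : v - v⁻¹ ≠ 0) : qint v 2 = v + v⁻¹ := by
  unfold qint
  rw [div_eq_iff h, zpow_neg]
  have : v ^ (2 : ℤ) = v ^ 2 := by norm_cast
  rw [this, ← inv_pow]
  ring

theorem qint_neg_one (v : ℂ) (h : v - v⁻¹ ≠ 0) : qint v (-1) = -1 := by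
  unfold qint
  rw [div_eq_iff h]
  simp

theorem even_part [FiniteDimensional ℂ V] (q : ℂ) (hq0 : q ≠ 0)
    (hq1 : ∀ k : ℕ, k ≠ 0 → q ^ k ≠ 1) (M N : ℕ)
    (π : FA M N true →ₐ[ℂ] Module.End ℂ V)
    (hrel : ∀ a b, rel q M N true 3 a b → π a = π b) (v : V) (hv : v ≠ 0)
    (hX : ∀ i n, π (gi (Gen.Xp i n)) v = 0)
    (hc : ∀ g, isCartan g → ∃ μ : ℂ, π (gi g) v = μ • v) (i : Idx M N) (hi : i.1 ≠ M) :
    ∃ (P : Polynomial ℂ) (ε : ℂ), (ε = 1 ∨ ε = -1) ∧ P.coeff 0 = 1 ∧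
      (∀ n, π (phiPF q M N true i.1 n) v = (ε * gammaP q M i.1 P n) • v) ∧
      (∀ n, π (phiMF q M N true i.1 n) v = (ε * gammaM q M i.1 P n) • v) ∧
      (π (gi (Gen.Xm i 0)) ^ (1 + P.natDegree)) v = 0 := by
  obtain ⟨gp, gm, k, hk0, hk, hP, hMm, hgp, hgm, hgp0, hgm0⟩ := phi_scalar q M N π hrel v hv hc i
  have hKF : KF M N true i.1 = gi (Gen.K i) := by rw [KF, dif_pos i.2]
  have hKiF : KiF M N true i.1 = gi (Gen.Ki i) := by rw [KiF, dif_pos i.2]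
  have hHF : HF M N true i.1 1 = gi (Gen.H i ⟨1, one_ne_zero⟩) := by
    rw [HF, dif_pos ⟨i.2, one_ne_zero⟩]
  have ha0 := qpar_ne q hq0 M i.1
  have ha1 := qpar_pow_ne q hq1 M i.1
  have haa := sub_inv_ne _ ha0 ha1
  have hcc := cc_self M i.1 hi
  have hccp : q ^ cc M i.1 i.1 = qpar q M i.1 ^ 2 := by
    rw [hcc, qpar, ← zpow_natCast, ← zpow_mul, mul_comm]; rfl
  have hccm : q ^ (-cc M i.1 i.1) = (qpar q M i.1)⁻¹ ^ 2 := by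
    rw [zpow_neg, hccp, inv_pow]
  have hcc0 : cc M i.1 i.1 ≠ 0 := by
    rw [hcc]; unfold lof; split_ifs <;> omega
  have hsg : sgn M i.1 i.1 = 1 := by
    rw [sgn, if_neg]; tauto
  have hqi : qint (qpar q M i.1) (1 * lof M i.1 * cc M i.1 i.1) / ((1 : ℤ) : ℂ) =
      qpar q M i.1 + (qpar q M i.1)⁻¹ := by
    rw [hcc, show 1 * lof M i.1 * (2 * lof M i.1) = 2 by linear_combination 2 * lof_sq M i.1,
      qint_two _ haa]
    simp
  have hphiP0 : phiPF q M N true i.1 0 = gi (Gen.K i) := by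
    rw [phiPF, if_pos le_rfl, hKF]; simp [expC]
  have hphiM0 : phiMF q M N true i.1 0 = gi (Gen.Ki i) := by
    rw [phiMF, if_pos le_rfl, hKiF]; simp [expC]
  have hphiP1 : phiPF q M N true i.1 1 =
      (qpar q M i.1 - (qpar q M i.1)⁻¹) • (gi (Gen.K i) * gi (Gen.H i ⟨1, one_ne_zero⟩)) := by
    rw [phiPF, if_pos zero_le_one, hKF, ← hHF]; simp [expC]
  have hphiM1 : phiMF q M N true i.1 1 = 0 := by
    rw [phiMF, if_neg (by norm_num)]
  have hXX : ∀ m n : ℤ, π (gi (Gen.Xp i m)) * π (gi (Gen.Xm i n)) =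
      π (gi (Gen.Xm i n)) * π (gi (Gen.Xp i m)) + (qpar q M i.1 - (qpar q M i.1)⁻¹)⁻¹ •
        (π (phiPF q M N true i.1 (m + n)) - π (phiMF q M N true i.1 (m + n))) := by
    intro m n
    have h := hrel _ _ (rel.XpXm i i m n)
    rw [if_pos rfl, hsg, one_smul, map_sub, map_mul, map_mul, map_smul, map_sub] at h
    rw [← h]; abel
  obtain ⟨l, hl⟩ := hc (Gen.H i ⟨1, one_ne_zero⟩) trivial
  obtain ⟨u, ε, hε, hu0, hkε, hconv, htwo, hnil⟩ := drinfeld (π (gi (Gen.Xp i 0)))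
    (π (gi (Gen.H i ⟨1, one_ne_zero⟩))) (π (gi (Gen.K i))) (π (gi (Gen.Ki i)))
    (π (gi (Gen.Xp i 1))) (fun n => π (gi (Gen.Xm i n))) (qpar q M i.1) k l v gp gm hv ha0 ha1 hk0
    (by
      rw [hXX, zero_add, hphiP1, hphiM1, map_zero, sub_zero, map_smul, inv_smul_smul₀ haa, map_mul])
    (by rw [← map_mul, ← map_mul]; exact hrel _ _ (rel.KH i i _))
    (by
      intro n
      rw [← map_mul, hrel _ _ (rel.KXm i i n), map_smul, map_mul, hccm])
    (by rw [← map_mul, hrel _ _ (rel.KXp i i 0), map_smul, map_mul, hccp])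
    (by
      intro n
      have h := hrel _ _ (rel.HXm i i ⟨1, one_ne_zero⟩ n)
      rw [map_sub, map_mul, map_mul, map_neg, map_smul, hqi] at h
      rw [sub_eq_add_neg, ← h]; abel)
    (by
      have h := hrel _ _ (rel.HXp i i ⟨1, one_ne_zero⟩ 0)
      rw [map_sub, map_mul, map_mul, map_smul, hqi] at h
      rw [zero_add] at h
      rw [← h]; abel)
    (by
      have h := hrel _ _ (rel.XXm i i 1 1 (by norm_num) hcc0)
      rw [hccm] at h
      simp only [map_sub, map_smul, map_mul, Int.reduceAdd] at h
      have ha2 : (2 : ℂ) ≠ 0 := two_ne_zero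
      have h2 : (2 : ℂ) • (π (gi (Gen.Xm i 2)) * π (gi (Gen.Xm i 1))) =
          (2 : ℂ) • (((qpar q M i.1)⁻¹ ^ 2) • (π (gi (Gen.Xm i 1)) * π (gi (Gen.Xm i 2)))) := by
        rw [two_smul, two_smul]
        rw [sub_eq_iff_eq_add] at h
        nth_rewrite 1 [h]
        abel
      exact smul_right_injective _ ha2 h2)
    (by
      have h := hrel _ _ (rel.XXp i i 0 0 (by norm_num) hcc0)
      rw [hccp] at h
      simp only [map_sub, map_smul, map_mul, zero_add] at h
      have ha2 : (2 : ℂ) ≠ 0 := two_ne_zero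
      have h2 : (2 : ℂ) • (π (gi (Gen.Xp i 1)) * π (gi (Gen.Xp i 0))) =
          (2 : ℂ) • ((qpar q M i.1 ^ 2) • (π (gi (Gen.Xp i 0)) * π (gi (Gen.Xp i 1)))) := by
        rw [two_smul, two_smul]
        rw [sub_eq_iff_eq_add] at h
        nth_rewrite 1 [h]
        abel
      exact smul_right_injective _ ha2 h2)
    (by rw [hXX, zero_add, hphiP0, hphiM0])
    (by rw [← map_mul, hrel _ _ (rel.KiK i), map_one])
    (hX i 0) hk hl hgp hgm hgp0 hgm0
    (by
      intro n
      rw [← Module.End.mul_apply, hXX, zero_add, LinearMap.add_apply, Module.End.mul_apply, hX,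
        map_zero, zero_add, LinearMap.smul_apply, LinearMap.sub_apply, hP, hMm, ← sub_smul,
        smul_smul])
  refine ⟨pscale (qpar q M i.1)⁻¹ u, ε, hε, ?_, ?_, ?_, ?_⟩
  · rw [pscale_coeff, hu0, pow_zero, mul_one]
  · intro n
    rw [hP, gamma_P q M i.1 ha0 u hu0 k ε hkε gp hgp hconv]
  · intro n
    rw [hMm, gamma_M q M i.1 ha0 u hu0 k ε hkε gp gm hgp hgm hconv htwo]
  · rw [pscale_natDegree _ (inv_ne_zero ha0)]; exact hnil

theorem odd_part [FiniteDimensional ℂ V] (q : ℂ) (hq0 : q ≠ 0)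
    (hq1 : ∀ k : ℕ, k ≠ 0 → q ^ k ≠ 1) (M N : ℕ) (hM : 1 ≤ M) (hN : 1 ≤ N)
    (hMN : ¬(M = 1 ∧ N = 1))
    (π : FA M N true →ₐ[ℂ] Module.End ℂ V)
    (hrel : ∀ a b, rel q M N true 3 a b → π a = π b) (v : V) (hv : v ≠ 0)
    (hX : ∀ i n, π (gi (Gen.Xp i n)) v = 0)
    (hc : ∀ g, isCartan g → ∃ μ : ℂ, π (gi g) v = μ • v) (i : Idx M N) (hi : i.1 = M) :
    ∃ (f : ℤ → ℂ) (c : ℂ) (Q : Polynomial ℂ), c ≠ 0 ∧ Q.coeff 0 = 1 ∧ annih Q f ∧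
      f 0 = (c - c⁻¹) / (q - q⁻¹) ∧ π (gi (Gen.K i)) v = c • v ∧
      (∀ n, π (phiPF q M N true i.1 n - phiMF q M N true i.1 n) v = ((q - q⁻¹) * f n) • v) ∧
      ∑ s ∈ Finset.range (Q.natDegree + 1),
        Q.coeff (Q.natDegree - s) • π (gi (Gen.Xm i s)) v = 0 := by
  obtain ⟨gp, gm, k, hk0, hk, hP, hMm, hgp, hgm, hgp0, hgm0⟩ := phi_scalar q M N π hrel v hv hc i
  have hqq := sub_inv_ne q hq0 hq1
  have hqp : qpar q M i.1 = q := by rw [qpar, lof, if_pos (by omega), zpow_one]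
  -- a neighbour
  obtain ⟨j, hj⟩ : ∃ j : Idx M N, 1 * lof M j.1 * cc M j.1 i.1 = -1 := by
    by_cases h2 : 2 ≤ M
    · refine ⟨⟨M - 1, by omega, by omega⟩, ?_⟩
      rw [hi]
      change 1 * lof M (M - 1) * cc M (M - 1) M = -1
      unfold cc form4 innerE lof
      split_ifs <;> omega
    · refine ⟨⟨M + 1, by omega, by omega⟩, ?_⟩
      rw [hi]
      change 1 * lof M (M + 1) * cc M (M + 1) M = -1
      unfold cc form4 innerE lof
      split_ifs <;> omega
  obtain ⟨l, hl⟩ := hc (Gen.H j ⟨1, one_ne_zero⟩) trivial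
  obtain ⟨r, hrm, hr0, hr⟩ := shift_lemma
    (π (gi (Gen.H j ⟨1, one_ne_zero⟩)) - l • (1 : Module.End ℂ V))
    (fun n => π (gi (Gen.Xm i n)) v) (by
      intro n
      have h := congrArg (fun f : Module.End ℂ V => f v) (hrel _ _ (rel.HXm j i ⟨1, one_ne_zero⟩ n))
      simp only [] at h
      rw [hj, qint_neg_one _ (sub_inv_ne _ (qpar_ne q hq0 M j.1) (qpar_pow_ne q hq1 M j.1))] at h
      simpa [hl] using h)
  have hXX : ∀ n : ℤ, π (gi (Gen.Xp i 0)) (π (gi (Gen.Xm i n)) v) =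
      ((q - q⁻¹)⁻¹ * (gp n - gm n)) • v := by
    intro n
    have h := congrArg (fun f : Module.End ℂ V => f v) (hrel _ _ (rel.XpXm i i 0 n))
    simp only [if_true, hqp, zero_add, map_sub, map_mul, map_smul, LinearMap.sub_apply,
      Module.End.mul_apply, LinearMap.smul_apply, hX, map_zero, smul_zero, sub_zero, hP, hMm] at h
    rw [h, ← sub_smul, smul_smul]
  have hdeg : r.reverse.natDegree = r.natDegree := by
    rw [Polynomial.reverse_natDegree, Polynomial.natTrailingDegree_eq_zero.mpr (Or.inr hr0)]
    rfl
  have hcoef : ∀ s ≤ r.natDegree, r.reverse.coeff s = r.coeff (r.natDegree - s) := by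
    intro s hs
    rw [Polynomial.coeff_reverse, Polynomial.revAt_le hs]
  refine ⟨fun n => (q - q⁻¹)⁻¹ * (gp n - gm n), k, r.reverse, hk0, ?_, ?_, ?_, hk, ?_, ?_⟩
  · rw [Polynomial.coeff_zero_reverse, hrm]
  · intro n
    rw [hdeg]
    have h := congrArg (π (gi (Gen.Xp i 0))) (hr (n - r.natDegree))
    simp only [map_sum, map_smul, hXX, map_zero, smul_smul, ← Finset.sum_smul] at h
    have h := (smul_eq_zero.mp h).resolve_right hv
    rw [← h, ← Finset.sum_range_reflect]
    apply Finset.sum_congr rfl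
    intro s hs
    simp only [Finset.mem_range] at hs
    rw [hcoef _ (by omega), show r.natDegree - (r.natDegree + 1 - 1 - s) = s by omega,
      show n - ((r.natDegree + 1 - 1 - s : ℕ) : ℤ) = n - r.natDegree + s by omega]
  · simp only [hgp0, hgm0, div_eq_inv_mul]
  · intro n
    rw [map_sub, LinearMap.sub_apply, hP, hMm, ← sub_smul, mul_inv_cancel_left₀ hqq]
  · rw [hdeg]
    have h := hr 0
    rw [← h]
    apply Finset.sum_congr rfl
    intro s hs
    simp only [Finset.mem_range] at hs
    rw [hcoef _ (by omega), show r.natDegree - (r.natDegree - s) = s by omega, zero_add]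

end mod6
end QASProof

open QAS in
/-- Lemma 4.16: every finite-dimensional nonzero `U'`-module contains a
nonzero vector `v` which is a highest weight vector up to signs: there are signs `ε_i`
(`i ≠ M`), `t ≠ 0` and `(P̲,f,c;Q) ∈ R̃_{M,N}` such that the listed relations hold. -/
theorem fd_module_hw_vector (q : ℂ) (hq0 : q ≠ 0)
    (hq1 : ∀ k : ℕ, k ≠ 0 → q ^ k ≠ 1) (M N : ℕ) (hM : 1 ≤ M) (hN : 1 ≤ N)
    (hMN : ¬(M = 1 ∧ N = 1))
    (V : Type) [AddCommGroup V] [Module (ALG q M N true 3) V] [Module ℂ V]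
    [IsScalarTower ℂ (ALG q M N true 3) V] [FiniteDimensional ℂ V] [Nontrivial V] :
    ∃ v : V, v ≠ 0 ∧ ∃ (ε : ℕ → ℂ) (t : ℂ) (Λ : HW q M N) (Q : Polynomial ℂ),
      t ≠ 0 ∧
      (∀ i : ℕ, 1 ≤ i → i ≤ M + N - 1 → i ≠ M → ε i = 1 ∨ ε i = -1) ∧
      Q.coeff 0 = 1 ∧ annih Q Λ.f ∧
      (∀ (i : ℕ) (n : ℤ), XpA q M N true 3 i n • v = 0) ∧
      K0A q M N true 3 • v = t • v ∧
      (∀ (i : ℕ) (n : ℤ), 1 ≤ i → i ≤ M + N - 1 → i ≠ M →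
        phiPA q M N true 3 i n • v = (ε i * gammaP q M i (Λ.P i) n) • v ∧
        phiMA q M N true 3 i n • v = (ε i * gammaM q M i (Λ.P i) n) • v) ∧
      KA q M N true 3 M • v = Λ.c • v ∧
      (∀ n : ℤ, (phiPA q M N true 3 M n - phiMA q M N true 3 M n) • v =
        ((q - q⁻¹) * Λ.f n) • v) ∧
      (∀ i : ℕ, 1 ≤ i → i ≤ M + N - 1 → i ≠ M →
        ((XmA q M N true 3 i 0) ^ (1 + (Λ.P i).natDegree)) • v = 0) ∧
      oddElt q M N true Q 0 • v = 0 := by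
  have hscc : SMulCommClass (ALG q M N true 3) ℂ V := IsScalarTower.to_smulCommClass'
  obtain ⟨π, hπ⟩ : ∃ π : FA M N true →ₐ[ℂ] Module.End ℂ V,
      ∀ a (w : V), π a w = mkA q M N true 3 a • w :=
    ⟨(Algebra.lsmul ℂ ℂ V : ALG q M N true 3 →ₐ[ℂ] Module.End ℂ V).comp (mkA q M N true 3),
      fun _ _ => rfl⟩
  have hrel : ∀ a b, rel q M N true 3 a b → π a = π b := by
    intro a b h
    ext w
    rw [hπ, hπ, mkA, RingQuot.mkAlgHom_rel ℂ h]
  obtain ⟨v, hv, hX, hc⟩ := QASProof.hwvec q hq0 hq1 M N hM π hrel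
  obtain ⟨f, c, Q, hc0, hQ0, hQf, hf0, hKc, hphi, hodd⟩ :=
    QASProof.odd_part q hq0 hq1 M N hM hN hMN π hrel v hv hX hc ⟨M, hM, by omega⟩ rfl
  have hev : ∀ i : ℕ, ∃ (P : Polynomial ℂ) (ε : ℂ), P.coeff 0 = 1 ∧
      ∀ (_ : 1 ≤ i) (_ : i ≤ M + N - 1), i ≠ M → (ε = 1 ∨ ε = -1) ∧
      (∀ n, π (phiPF q M N true i n) v = (ε * gammaP q M i P n) • v) ∧
      (∀ n, π (phiMF q M N true i n) v = (ε * gammaM q M i P n) • v) ∧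
      (π (XmF M N true i 0) ^ (1 + P.natDegree)) v = 0 := by
    intro i
    by_cases h : (1 ≤ i ∧ i ≤ M + N - 1) ∧ i ≠ M
    · obtain ⟨P, ε, h1, h2, h3, h4, h5⟩ :=
        QASProof.even_part q hq0 hq1 M N π hrel v hv hX hc ⟨i, h.1⟩ h.2
      refine ⟨P, ε, h2, fun _ _ _ => ⟨h1, h3, h4, ?_⟩⟩
      rw [XmF, dif_pos h.1]
      exact h5
    · exact ⟨1, 1, by simp, fun h1 h2 h3 => absurd ⟨⟨h1, h2⟩, h3⟩ h⟩
  choose P ε hP0 hP using hev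
  obtain ⟨t, ht⟩ := hc (Gen.K0 rfl) trivial
  have ht0 : t ≠ 0 := by
    rintro rfl
    have h1 := congrArg (fun f : Module.End ℂ V => f v) (hrel _ _ (rel.K0iK0 rfl))
    simp only [map_mul, map_one, Module.End.mul_apply, ht, zero_smul, map_zero,
      Module.End.one_apply] at h1
    exact hv h1.symm
  have hMr : 1 ≤ M ∧ M ≤ M + N - 1 := ⟨hM, by omega⟩
  refine ⟨v, hv, ε, t, ⟨P, f, c, hP0, hc0, ⟨Q, ?_, hQf⟩, hf0⟩, Q, ht0, ?_, hQ0, hQf, ?_, ?_, ?_, ?_,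
    ?_, ?_, ?_⟩
  · rintro rfl
    simp at hQ0
  · intro i h1 h2 h3
    exact (hP i h1 h2 h3).1
  · intro i n
    rw [XpA, ← hπ, XpF]
    split_ifs with h
    · exact hX _ _
    · simp
  · rw [K0A, ← hπ, K0F, dif_pos rfl]
    exact ht
  · intro i n h1 h2 h3
    obtain ⟨-, h4, h5, -⟩ := hP i h1 h2 h3
    rw [phiPA, phiMA, ← hπ, ← hπ]
    exact ⟨h4 n, h5 n⟩
  · rw [KA, ← hπ, KF, dif_pos hMr]
    exact hKc
  · intro n
    rw [phiPA, phiMA, ← map_sub, ← hπ]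
    exact hphi n
  · intro i h1 h2 h3
    obtain ⟨-, -, -, h4⟩ := hP i h1 h2 h3
    rw [XmA, ← map_pow, ← hπ, map_pow]
    exact h4
  · rw [oddElt]
    simp only [XmA, ← map_smul, ← map_sum]
    rw [← hπ, map_sum, LinearMap.sum_apply, ← hodd]
    apply Finset.sum_congr rfl
    intro s _
    rw [map_smul, LinearMap.smul_apply, XmF, dif_pos hMr, add_zero]
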